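/- arXiv:1012.4444 — 7 statements merged into one kernel-verified Lean document; each statement's English description precedes it below -/
import Mathlib

section
/- Let k ≥ m ≥ 1 be integers and let Q be a k×m matrix with integer entries such that det(Qᵀ·Q) = 1. Then at most m rows of Q are nonzero; more precisely, there is a set V of m row indices such that every row of Q with index outside V is the zero row. -/
open Matrix

/-- The diagonal entries of a symmetric idempotent integer matrix are sums of squares of rows. -/
theorem diag_eq_sum_sq_of_symm_idempotent {n : Type*} [Fintype n] {P : Matrix n n ℤ}
    (hsymm : Pᵀ = P) (hidem : P * P = P) (i : n) : P i i = ∑ j, P i j ^ 2 := by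
  conv_lhs => rw [← hidem, mul_apply]
  refine Finset.sum_congr rfl fun j _ => ?_
  rw [sq, ← transpose_apply P i j, hsymm]

/-- The diagonal entries of a symmetric idempotent integer matrix are `0` or `1`. -/
theorem diag_eq_zero_or_one_of_symm_idempotent {n : Type*} [Fintype n] {P : Matrix n n ℤ}
    (hsymm : Pᵀ = P) (hidem : P * P = P) (i : n) : P i i = 0 ∨ P i i = 1 := by
  have hsum := diag_eq_sum_sq_of_symm_idempotent hsymm hidem i
  have hle : P i i ^ 2 ≤ P i i := by
    conv_rhs => rw [hsum]
    exact Finset.single_le_sum (f := fun j => P i j ^ 2) (fun j _ => sq_nonneg _)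
      (Finset.mem_univ i)
  have h0 : 0 ≤ P i i := (sq_nonneg _).trans hle
  have h1 : P i i ≤ 1 := by nlinarith
  lia

/-- A row of a symmetric idempotent integer matrix vanishes if its diagonal entry does. -/
theorem row_eq_zero_of_symm_idempotent {n : Type*} [Fintype n] {P : Matrix n n ℤ}
    (hsymm : Pᵀ = P) (hidem : P * P = P) {i : n} (hi : P i i = 0) (j : n) : P i j = 0 := by
  have hsum := diag_eq_sum_sq_of_symm_idempotent hsymm hidem i
  rw [hi, eq_comm, Finset.sum_eq_zero_iff_of_nonneg fun j _ => sq_nonneg _] at hsum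
  exact pow_eq_zero_iff two_ne_zero |>.mp (hsum j (Finset.mem_univ j))

/-- Let `k ≥ m ≥ 1` be integers and `Q` a `k × m` integer matrix with
`det (Qᵀ · Q) = 1`. Then there is a set `V` of `m` row indices such that every row of `Q`
with index outside `V` is the zero row. -/
theorem stmt0 (k m : ℕ) (hm : 1 ≤ m) (hkm : m ≤ k)
    (Q : Matrix (Fin k) (Fin m) ℤ) (hdet : (Qᵀ * Q).det = 1) :
    ∃ V : Finset (Fin k), V.card = m ∧ ∀ i : Fin k, i ∉ V → ∀ j : Fin m, Q i j = 0 := by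
  have hunit : IsUnit (Qᵀ * Q).det := hdet ▸ isUnit_one
  -- the orthogonal projection onto the column space of `Q`, which has integer entries
  let P : Matrix (Fin k) (Fin k) ℤ := Q * (Qᵀ * Q)⁻¹ * Qᵀ
  have hPQ : P * Q = Q := by
    rw [Matrix.mul_assoc, Matrix.mul_assoc, nonsing_inv_mul _ hunit, Matrix.mul_one]
  have hidem : P * P = P := by
    change P * (Q * (Qᵀ * Q)⁻¹ * Qᵀ) = Q * (Qᵀ * Q)⁻¹ * Qᵀ
    rw [← Matrix.mul_assoc, ← Matrix.mul_assoc, hPQ]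
  have hsymm : Pᵀ = P := by
    simp [P, transpose_mul, transpose_nonsing_inv, Matrix.mul_assoc]
  have htrace : P.trace = m := by
    rw [trace_mul_comm, ← Matrix.mul_assoc, mul_nonsing_inv _ hunit, trace_one, Fintype.card_fin]
  have hdiag := diag_eq_zero_or_one_of_symm_idempotent hsymm hidem
  refine ⟨Finset.univ.filter fun i => P i i = 1, ?_, fun i hi j => ?_⟩
  · rw [Finset.card_filter]
    zify
    rw [← htrace, trace]
    refine Finset.sum_congr rfl fun i _ => ?_
    rcases hdiag i with h | h <;> simp [h]
  · have hi0 : P i i = 0 := (hdiag i).resolve_right (by simpa using hi)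
    rw [← hPQ, mul_apply]
    exact Finset.sum_eq_zero fun l _ => by
      rw [row_eq_zero_of_symm_idempotent hsymm hidem hi0, zero_mul]
end

section
/- Let N be a positive integer and let A ∈ ℤ^{2×2} be a symmetric positive definite matrix with det A = N. If A is not equivalent to any diagonal matrix, then A is equivalent to a symmetric matrix (c_{ij}) ∈ ℤ^{2×2} satisfying 2·(c₁₁ + c₂₂ − c₁₂) ≤ N + 3. -/
open Matrix

/-- Two integer matrices are equivalent if `A = Sᵀ * B * S` for some `S ∈ GL(l, ℤ)`. -/
def MatrixEquiv {l : ℕ} (A B : Matrix (Fin l) (Fin l) ℤ) : Prop :=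
  ∃ S : Matrix (Fin l) (Fin l) ℤ, IsUnit S.det ∧ A = Sᵀ * B * S

/-- A symmetric integer matrix is positive definite if the associated real quadratic
form takes positive values on all nonzero vectors. -/
def IntPosDef {l : ℕ} (A : Matrix (Fin l) (Fin l) ℤ) : Prop :=
  ∀ x : Fin l → ℝ, x ≠ 0 → 0 < ∑ i, ∑ j, x i * (A i j : ℝ) * x j

theorem MatrixEquiv.refl {l : ℕ} (A : Matrix (Fin l) (Fin l) ℤ) : MatrixEquiv A A :=
  ⟨1, by simp, by simp⟩

theorem MatrixEquiv.trans {l : ℕ} {A B C : Matrix (Fin l) (Fin l) ℤ}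
    (hAB : MatrixEquiv A B) (hBC : MatrixEquiv B C) : MatrixEquiv A C := by
  obtain ⟨S, hS, rfl⟩ := hAB
  obtain ⟨T, hT, rfl⟩ := hBC
  refine ⟨T * S, ?_, ?_⟩
  · rw [det_mul]
    exact hT.mul hS
  · simp only [transpose_mul, Matrix.mul_assoc]

theorem MatrixEquiv.det_eq {l : ℕ} {A B : Matrix (Fin l) (Fin l) ℤ}
    (h : MatrixEquiv A B) : A.det = B.det := by
  obtain ⟨S, hS, rfl⟩ := h
  rw [det_mul, det_mul, det_transpose]
  rcases Int.isUnit_iff.mp hS with h | h <;> simp [h]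

theorem matrixEquiv_upper_shear (a b c t : ℤ) :
    MatrixEquiv !![a, b; b, c]
      !![a, b - t * a; b - t * a, c - 2 * t * b + t ^ 2 * a] := by
  refine ⟨!![1, t; 0, 1], by simp [det_fin_two], ?_⟩
  ext i j
  fin_cases i <;> fin_cases j <;> simp [Matrix.mul_apply, Fin.sum_univ_two] <;> ring

theorem matrixEquiv_lower_shear (a b c t : ℤ) :
    MatrixEquiv !![a, b; b, c]
      !![a - 2 * t * b + t ^ 2 * c, b - t * c; b - t * c, c] := by
  refine ⟨!![1, 0; t, 1], by simp [det_fin_two], ?_⟩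
  ext i j
  fin_cases i <;> fin_cases j <;> simp [Matrix.mul_apply, Fin.sum_univ_two] <;> ring

theorem matrixEquiv_neg_offDiag (a b c : ℤ) :
    MatrixEquiv !![a, b; b, c] !![a, -b; -b, c] := by
  refine ⟨!![1, 0; 0, -1], by simp [det_fin_two], ?_⟩
  ext i j
  fin_cases i <;> fin_cases j <;> simp [Matrix.mul_apply, Fin.sum_univ_two]

/-- Reduction of positive definite binary forms: twice the off-diagonal entry can be made
at most each diagonal entry in absolute value. -/
theorem exists_matrixEquiv_abs_le (n : ℕ) (a b c : ℤ) (hn : a + c ≤ n) (ha : 0 < a)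
    (hc : 0 < c) (hd : 0 < a * c - b ^ 2) :
    ∃ a' b' c' : ℤ, MatrixEquiv !![a, b; b, c] !![a', b'; b', c'] ∧
      2 * |b'| ≤ a' ∧ 2 * |b'| ≤ c' := by
  induction n generalizing a b c with
  | zero => push_cast at hn; omega
  | succ n ih =>
    push_cast at hn
    have upper (t : ℤ) (ht : -(2 * t * b) + t ^ 2 * a < 0) :
        ∃ a' b' c' : ℤ, MatrixEquiv !![a, b; b, c] !![a', b'; b', c'] ∧
          2 * |b'| ≤ a' ∧ 2 * |b'| ≤ c' := by
      have hd' : 0 < a * (c - 2 * t * b + t ^ 2 * a) - (b - t * a) ^ 2 := by linarith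
      obtain ⟨a', b', c', h, hr⟩ := ih a (b - t * a) (c - 2 * t * b + t ^ 2 * a)
        (by linarith) ha
        (pos_of_mul_pos_right (by linarith [sq_nonneg (b - t * a)]) ha.le) hd'
      exact ⟨a', b', c', (matrixEquiv_upper_shear a b c t).trans h, hr⟩
    have lower (t : ℤ) (ht : -(2 * t * b) + t ^ 2 * c < 0) :
        ∃ a' b' c' : ℤ, MatrixEquiv !![a, b; b, c] !![a', b'; b', c'] ∧
          2 * |b'| ≤ a' ∧ 2 * |b'| ≤ c' := by
      have hd' : 0 < (a - 2 * t * b + t ^ 2 * c) * c - (b - t * c) ^ 2 := by linarith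
      obtain ⟨a', b', c', h, hr⟩ := ih (a - 2 * t * b + t ^ 2 * c) (b - t * c) c
        (by linarith)
        (pos_of_mul_pos_left (by linarith [sq_nonneg (b - t * c)]) hc.le) hc hd'
      exact ⟨a', b', c', (matrixEquiv_lower_shear a b c t).trans h, hr⟩
    by_cases h₁ : a < 2 * b
    · exact upper 1 (by linarith)
    by_cases h₂ : a < -(2 * b)
    · exact upper (-1) (by linarith)
    by_cases h₃ : c < 2 * b
    · exact lower 1 (by linarith)
    by_cases h₄ : c < -(2 * b)
    · exact lower (-1) (by linarith)
    refine ⟨a, b, c, .refl _, ?_, ?_⟩ <;> rcases abs_cases b with ⟨h, _⟩ | ⟨h, _⟩ <;> omega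

theorem IntPosDef.diag_pos {l : ℕ} {A : Matrix (Fin l) (Fin l) ℤ} (h : IntPosDef A)
    (i : Fin l) : 0 < A i i := by
  have := h (Pi.single i 1) (by simp)
  simpa [Pi.single_apply] using this

/-- A symmetric positive definite `2 × 2` integer matrix of determinant `N`
which is not equivalent to any diagonal matrix is equivalent to a symmetric matrix `(c_{ij})`
with `2 (c₁₁ + c₂₂ − c₁₂) ≤ N + 3`. -/
theorem stmt3 (N : ℤ) (hN : 0 < N) (A : Matrix (Fin 2) (Fin 2) ℤ)
    (hsymm : Aᵀ = A) (hpos : IntPosDef A) (hdet : A.det = N)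
    (hdiag : ¬ ∃ D : Matrix (Fin 2) (Fin 2) ℤ, (∀ i j, i ≠ j → D i j = 0) ∧ MatrixEquiv A D) :
    ∃ C : Matrix (Fin 2) (Fin 2) ℤ, MatrixEquiv A C ∧ Cᵀ = C ∧
      2 * (C 0 0 + C 1 1 - C 0 1) ≤ N + 3 := by
  have h10 : A 1 0 = A 0 1 := congrFun (congrFun hsymm 0) 1
  have hA : A = !![A 0 0, A 0 1; A 0 1, A 1 1] := by
    conv_lhs => rw [eta_fin_two A, h10]
  have hd : 0 < A 0 0 * A 1 1 - A 0 1 ^ 2 := by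
    rw [det_fin_two, h10] at hdet
    linarith
  obtain ⟨a, b, c, h, hba, hbc⟩ := exists_matrixEquiv_abs_le (A 0 0 + A 1 1).toNat
    (A 0 0) (A 0 1) (A 1 1) (Int.self_le_toNat _) (hpos.diag_pos 0) (hpos.diag_pos 1) hd
  rw [← hA] at h
  have hb : b ≠ 0 := by
    rintro rfl
    refine hdiag ⟨_, fun i j hij => ?_, h⟩
    fin_cases i <;> fin_cases j <;> first | rfl | exact absurd rfl hij
  have hb1 : 1 ≤ |b| := Int.one_le_abs hb
  have hC : MatrixEquiv A !![a, |b|; |b|, c] := by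
    rcases abs_choice b with hb' | hb' <;> rw [hb']
    · exact h
    · exact h.trans (matrixEquiv_neg_offDiag a b c)
  have hdetC : N = a * c - |b| * |b| := by
    rw [← hdet, hC.det_eq, det_fin_two_of]
  refine ⟨_, hC, ?_, ?_⟩
  · ext i j
    fin_cases i <;> fin_cases j <;> rfl
  · simp only [of_apply, cons_val_zero, cons_val_one, cons_val', cons_val_fin_one]
    nlinarith [mul_le_mul (show 2 * (|b| - 1) ≤ a - 2 by linarith)
      (show 2 * (|b| - 1) ≤ c - 2 by linarith) (by linarith) (by linarith),
      sq_nonneg (|b| - 1)]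
end

section
/- Let N be a positive integer and let A ∈ ℤ^{3×3} be a symmetric positive definite matrix with det A = N. If A is not equivalent to any decomposable matrix, then A is equivalent to a symmetric matrix (c_{ij}) ∈ ℤ^{3×3} satisfying 3·(c₁₁ + c₂₂ + c₃₃ − c₁₂ − c₂₃) ≤ N + 8. -/
open Matrix

/-- A matrix is decomposable if some simultaneous permutation of the rows and columns
turns it into a nontrivial direct sum, i.e. both off-diagonal blocks vanish. -/
def Decomposable {l : ℕ} (A : Matrix (Fin l) (Fin l) ℤ) : Prop :=
  ∃ σ : Equiv.Perm (Fin l), ∃ m : ℕ, 0 < m ∧ m < l ∧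
    ∀ i j : Fin l, (i : ℕ) < m → m ≤ (j : ℕ) →
      A (σ i) (σ j) = 0 ∧ A (σ j) (σ i) = 0

/-- Half the sum of the norms of the superbase `e₁, e₂ - e₁, e₃ - e₂, -e₃` with respect to the
symmetric form `C`. -/
def sellingSum (C : Matrix (Fin 3) (Fin 3) ℤ) : ℤ :=
  C 0 0 + C 1 1 + C 2 2 - C 0 1 - C 1 2

theorem matrixEquiv_transpose_mul_mul {l : ℕ} (A P : Matrix (Fin l) (Fin l) ℤ)
    (hP : IsUnit P.det) : MatrixEquiv A (Pᵀ * A * P) := by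
  refine ⟨P⁻¹, P.isUnit_nonsing_inv_det hP, ?_⟩
  have h : (P⁻¹)ᵀ * Pᵀ = 1 := by
    rw [← transpose_mul, mul_nonsing_inv _ hP, transpose_one]
  calc A = ((P⁻¹)ᵀ * Pᵀ) * A * (P * P⁻¹) := by
        rw [h, mul_nonsing_inv _ hP, Matrix.one_mul, Matrix.mul_one]
    _ = _ := by simp only [Matrix.mul_assoc]

theorem IntPosDef.dotProduct_mulVec_nonneg {l : ℕ} {A : Matrix (Fin l) (Fin l) ℤ}
    (hA : IntPosDef A) (x : Fin l → ℤ) : 0 ≤ x ⬝ᵥ A *ᵥ x := by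
  by_cases hx : x = 0
  · simp [hx]
  have h := hA (fun i => (x i : ℝ)) (fun h0 => hx (by
    ext i
    simpa using congrFun h0 i))
  have h' : (0 : ℤ) < ∑ i, ∑ j, x i * A i j * x j := by exact_mod_cast h
  simpa [dotProduct, mulVec, Finset.mul_sum, mul_assoc] using h'.le

theorem sellingSum_nonneg {C : Matrix (Fin 3) (Fin 3) ℤ} (hsymm : Cᵀ = C)
    (hC : ∀ x : Fin 3 → ℤ, 0 ≤ x ⬝ᵥ C *ᵥ x) : 0 ≤ sellingSum C := by
  have h10 : C 1 0 = C 0 1 := congrFun (congrFun hsymm 0) 1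
  have h21 : C 2 1 = C 1 2 := congrFun (congrFun hsymm 1) 2
  have h1 := hC ![1, 0, 0]
  have h2 := hC ![-1, 1, 0]
  have h3 := hC ![0, -1, 1]
  have h4 := hC ![0, 0, -1]
  simp [dotProduct, mulVec, Fin.sum_univ_three] at h1 h2 h3 h4
  unfold sellingSum
  linarith

theorem decomposable_of_apply_eq_zero {D : Matrix (Fin 3) (Fin 3) ℤ} (hsymm : Dᵀ = D)
    (h1 : D 0 1 = 0) (h2 : D 0 2 = 0) : Decomposable D := by
  refine ⟨1, 1, by norm_num, by norm_num, fun i j hi hj => ?_⟩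
  have hij : D i j = 0 := by
    obtain rfl : i = 0 := Fin.ext (by simpa using hi)
    fin_cases j <;> simp_all
  exact ⟨hij, (congrFun (congrFun hsymm i) j).trans hij⟩

/-- A lower bound for the Laplacian determinant of a nonnegatively weighted `K₄` whose support
contains a Hamiltonian cycle: the three perfect matchings carry the weights `p, s`, then `q, t`,
then `r, u`, and a Hamiltonian cycle is the union of two of them. -/
theorem three_mul_sum_le_spanning_trees {p s q t r u : ℤ}
    (hp : 0 ≤ p) (hs : 0 ≤ s) (hq : 0 ≤ q) (ht : 0 ≤ t) (hr : 0 ≤ r) (hu : 0 ≤ u)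
    (h : (p ≠ 0 ∧ s ≠ 0 ∧ q ≠ 0 ∧ t ≠ 0) ∨ (p ≠ 0 ∧ s ≠ 0 ∧ r ≠ 0 ∧ u ≠ 0) ∨
      (q ≠ 0 ∧ t ≠ 0 ∧ r ≠ 0 ∧ u ≠ 0)) :
    3 * (p + s + q + t + r + u) ≤
      !![p + q + r, q + r, r; q + r, u + t + q + r, t + r; r, t + r, s + t + r].det + 8 := by
  have key (x : ℤ) (hx : 0 ≤ x) (h0 : x ≠ 0) : ∃ n : ℕ, x = n + 1 := by
    obtain ⟨n, hn⟩ := Int.eq_ofNat_of_zero_le (show 0 ≤ x - 1 by omega)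
    exact ⟨n, by linarith⟩
  rw [← sub_nonneg]
  simp only [det_fin_three, of_apply, cons_val]
  rcases h with ⟨h1, h2, h3, h4⟩ | ⟨h1, h2, h3, h4⟩ | ⟨h1, h2, h3, h4⟩
  · obtain ⟨p, rfl⟩ := key p hp h1
    obtain ⟨s, rfl⟩ := key s hs h2
    obtain ⟨q, rfl⟩ := key q hq h3
    obtain ⟨t, rfl⟩ := key t ht h4
    ring_nf
    positivity
  · obtain ⟨p, rfl⟩ := key p hp h1
    obtain ⟨s, rfl⟩ := key s hs h2
    obtain ⟨r, rfl⟩ := key r hr h3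
    obtain ⟨u, rfl⟩ := key u hu h4
    ring_nf
    positivity
  · obtain ⟨q, rfl⟩ := key q hq h1
    obtain ⟨t, rfl⟩ := key t ht h2
    obtain ⟨r, rfl⟩ := key r hr h3
    obtain ⟨u, rfl⟩ := key u hu h4
    ring_nf
    positivity

set_option maxHeartbeats 1000000 in
/-- A form whose superbase `e₁, e₂ - e₁, e₃ - e₂, -e₃` has minimal norm sum is obtuse
(Selling reduced); if it is moreover indecomposable, the determinant bounds this sum. -/
theorem three_mul_sellingSum_le_det {C : Matrix (Fin 3) (Fin 3) ℤ} (hsymm : Cᵀ = C)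
    (hmin : ∀ P : Matrix (Fin 3) (Fin 3) ℤ, IsUnit P.det →
      sellingSum C ≤ sellingSum (Pᵀ * C * P))
    (hind : ∀ P : Matrix (Fin 3) (Fin 3) ℤ, IsUnit P.det →
      ¬ ((Pᵀ * C * P) 0 1 = 0 ∧ (Pᵀ * C * P) 0 2 = 0)) :
    3 * sellingSum C ≤ C.det + 8 := by
  obtain ⟨a, b, c, d, e, f, rfl⟩ :
      ∃ a b c d e f : ℤ, C = !![a, b, c; b, d, e; c, e, f] := by
    refine ⟨C 0 0, C 0 1, C 0 2, C 1 1, C 1 2, C 2 2, ?_⟩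
    have h10 : C 1 0 = C 0 1 := congrFun (congrFun hsymm 0) 1
    have h20 : C 2 0 = C 0 2 := congrFun (congrFun hsymm 0) 2
    have h21 : C 2 1 = C 1 2 := congrFun (congrFun hsymm 1) 2
    ext i j
    fin_cases i <;> fin_cases j <;> simp [h10, h20, h21]
  have h12 : 0 ≤ a - b := by
    have := hmin !![-1, -2, -1; 0, 1, 0; 0, 0, 1] (by simp [det_fin_three])
    simp [sellingSum, mul_apply, Fin.sum_univ_three] at this
    linarith
  have h13 : 0 ≤ b - c := by
    have := hmin !![-1, -1, -1; 0, -1, 0; 0, 1, 1] (by simp [det_fin_three])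
    simp [sellingSum, mul_apply, Fin.sum_univ_three] at this
    linarith
  have h01 : 0 ≤ c := by
    have := hmin !![0, 1, 0; 0, 0, 1; 1, 1, 0] (by simp [det_fin_three])
    simp [sellingSum, mul_apply, Fin.sum_univ_three] at this
    linarith
  have h23 : 0 ≤ d + c - e - b := by
    have := hmin !![1, 1, 1; -1, -2, -1; 0, 1, 1] (by simp [det_fin_three])
    simp [sellingSum, mul_apply, Fin.sum_univ_three] at this
    linarith
  have h02 : 0 ≤ e - c := by
    have := hmin !![0, -1, 0; 0, 1, 1; 1, 1, 0] (by simp [det_fin_three])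
    simp [sellingSum, mul_apply, Fin.sum_univ_three] at this
    linarith
  have h03 : 0 ≤ f - e := by
    have := hmin !![0, 0, 1; 0, -1, -1; 1, 2, 1] (by simp [det_fin_three])
    simp [sellingSum, mul_apply, Fin.sum_univ_three] at this
    linarith
  have o123 : ¬ (a - b = 0 ∧ b - c = 0) := by
    rintro ⟨h, h'⟩
    refine hind !![1, -1, 0; 0, 1, -1; 0, 0, 1] (by simp [det_fin_three]) ?_
    simp [mul_apply, Fin.sum_univ_three]
    constructor <;> linarith
  have o120 : ¬ (a - b = 0 ∧ c = 0) := by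
    rintro ⟨h, h'⟩
    refine hind !![1, -1, 0; 0, 1, 0; 0, 0, -1] (by simp [det_fin_three]) ?_
    simp [mul_apply, Fin.sum_univ_three]
    constructor <;> linarith
  have o130 : ¬ (b - c = 0 ∧ c = 0) := by
    rintro ⟨h, h'⟩
    refine hind !![1, 0, 0; 0, -1, 0; 0, 1, -1] (by simp [det_fin_three]) ?_
    simp [mul_apply, Fin.sum_univ_three]
    constructor <;> linarith
  have o213 : ¬ (a - b = 0 ∧ d + c - e - b = 0) := by
    rintro ⟨h, h'⟩
    refine hind !![-1, 1, 0; 1, 0, -1; 0, 0, 1] (by simp [det_fin_three]) ?_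
    simp [mul_apply, Fin.sum_univ_three]
    constructor <;> linarith
  have o210 : ¬ (a - b = 0 ∧ e - c = 0) := by
    rintro ⟨h, h'⟩
    refine hind !![-1, 1, 0; 1, 0, 0; 0, 0, -1] (by simp [det_fin_three]) ?_
    simp [mul_apply, Fin.sum_univ_three]
    constructor <;> linarith
  have o230 : ¬ (d + c - e - b = 0 ∧ e - c = 0) := by
    rintro ⟨h, h'⟩
    refine hind !![-1, 0, 0; 1, -1, 0; 0, 1, -1] (by simp [det_fin_three]) ?_
    simp [mul_apply, Fin.sum_univ_three]
    constructor <;> linarith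
  have o312 : ¬ (b - c = 0 ∧ d + c - e - b = 0) := by
    rintro ⟨h, h'⟩
    refine hind !![0, 1, -1; -1, 0, 1; 1, 0, 0] (by simp [det_fin_three]) ?_
    simp [mul_apply, Fin.sum_univ_three]
    constructor <;> linarith
  have o310 : ¬ (b - c = 0 ∧ f - e = 0) := by
    rintro ⟨h, h'⟩
    refine hind !![0, 1, 0; -1, 0, 0; 1, 0, -1] (by simp [det_fin_three]) ?_
    simp [mul_apply, Fin.sum_univ_three]
    constructor <;> linarith
  have o320 : ¬ (d + c - e - b = 0 ∧ f - e = 0) := by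
    rintro ⟨h, h'⟩
    refine hind !![0, -1, 0; -1, 1, 0; 1, 0, -1] (by simp [det_fin_three]) ?_
    simp [mul_apply, Fin.sum_univ_three]
    constructor <;> linarith
  have o012 : ¬ (c = 0 ∧ e - c = 0) := by
    rintro ⟨h, h'⟩
    refine hind !![0, 1, -1; 0, 0, 1; -1, 0, 0] (by simp [det_fin_three]) ?_
    simp [mul_apply, Fin.sum_univ_three]
    constructor <;> linarith
  have o013 : ¬ (c = 0 ∧ f - e = 0) := by
    rintro ⟨h, h'⟩
    refine hind !![0, 1, 0; 0, 0, -1; -1, 0, 1] (by simp [det_fin_three]) ?_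
    simp [mul_apply, Fin.sum_univ_three]
    constructor <;> linarith
  have o023 : ¬ (e - c = 0 ∧ f - e = 0) := by
    rintro ⟨h, h'⟩
    refine hind !![0, -1, 0; 0, 1, -1; -1, 0, 1] (by simp [det_fin_three]) ?_
    simp [mul_apply, Fin.sum_univ_three]
    constructor <;> linarith
  have h := three_mul_sum_le_spanning_trees h12 h03 h13 h02 h01 h23 (by grind)
  simp only [det_fin_three, of_apply, cons_val, sellingSum] at h ⊢
  linarith

/-- A symmetric positive definite `3 × 3` integer matrix of determinant `N`
which is not equivalent to any decomposable matrix is equivalent to a symmetric matrix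
`(c_{ij})` with `3 (c₁₁ + c₂₂ + c₃₃ − c₁₂ − c₂₃) ≤ N + 8`. -/
theorem stmt4 (N : ℤ) (hN : 0 < N) (A : Matrix (Fin 3) (Fin 3) ℤ)
    (hsymm : Aᵀ = A) (hpos : IntPosDef A) (hdet : A.det = N)
    (hdec : ¬ ∃ D : Matrix (Fin 3) (Fin 3) ℤ, Decomposable D ∧ MatrixEquiv A D) :
    ∃ C : Matrix (Fin 3) (Fin 3) ℤ, MatrixEquiv A C ∧ Cᵀ = C ∧
      3 * (C 0 0 + C 1 1 + C 2 2 - C 0 1 - C 1 2) ≤ N + 8 := by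
  let s : Set ℕ := {n | ∃ P : Matrix (Fin 3) (Fin 3) ℤ, IsUnit P.det ∧
      sellingSum (Pᵀ * A * P) = n}
  have hsymm' (P : Matrix (Fin 3) (Fin 3) ℤ) : (Pᵀ * A * P)ᵀ = Pᵀ * A * P := by
    simp [transpose_mul, hsymm, Matrix.mul_assoc]
  have hnonneg (P : Matrix (Fin 3) (Fin 3) ℤ) : 0 ≤ sellingSum (Pᵀ * A * P) := by
    refine sellingSum_nonneg (hsymm' P) fun x => ?_
    have h := hpos.dotProduct_mulVec_nonneg (P *ᵥ x)
    rwa [← mulVec_mulVec, ← mulVec_mulVec, dotProduct_mulVec x, vecMul_transpose]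
  have hmem (P : Matrix (Fin 3) (Fin 3) ℤ) (hP : IsUnit P.det) :
      (sellingSum (Pᵀ * A * P)).toNat ∈ s :=
    ⟨P, hP, (Int.toNat_of_nonneg (hnonneg P)).symm⟩
  obtain ⟨P, hP, hPs⟩ : sInf s ∈ s := Nat.sInf_mem ⟨_, hmem 1 (by simp)⟩
  have hcomp (Q : Matrix (Fin 3) (Fin 3) ℤ) :
      Qᵀ * (Pᵀ * A * P) * Q = (P * Q)ᵀ * A * (P * Q) := by
    simp only [transpose_mul, Matrix.mul_assoc]
  have hunit (Q : Matrix (Fin 3) (Fin 3) ℤ) (hQ : IsUnit Q.det) : IsUnit (P * Q).det := by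
    rw [det_mul]
    exact hP.mul hQ
  refine ⟨Pᵀ * A * P, matrixEquiv_transpose_mul_mul A P hP, hsymm' P, ?_⟩
  have hdetC : (Pᵀ * A * P).det = N := by
    have : P.det * P.det = 1 := Int.isUnit_mul_self hP
    rw [det_mul, det_mul, det_transpose, hdet, mul_right_comm, this, one_mul]
  rw [← hdetC]
  refine three_mul_sellingSum_le_det (hsymm' P) (fun Q hQ => ?_) (fun Q hQ h => ?_)
  · rw [hPs, hcomp, ← Int.toNat_of_nonneg (hnonneg (P * Q))]
    exact_mod_cast Nat.sInf_le (hmem (P * Q) (hunit Q hQ))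
  · rw [hcomp] at h
    exact hdec ⟨_, decomposable_of_apply_eq_zero (hsymm' _) h.1 h.2,
      matrixEquiv_transpose_mul_mul A _ (hunit Q hQ)⟩
end

section
/- Let q = p^d be a power of an odd prime p and let A ∈ ℤ^{4×4} be a symmetric positive definite matrix with det A = q. If A is not equivalent to any decomposable matrix, then there exist a symmetric matrix (c_{ij}) ∈ ℤ^{4×4} equivalent to A and a positive definite integral quadratic form Σ_{1≤i≤j≤4} q_{ij} x_i x_j such that 4·Σ_{1≤i≤j≤4} q_{ij}·c_{ij} ≤ q + 15. -/
open Matrix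

/-- An integral quadratic form `Σ_{i ≤ j} q_{ij} x_i x_j` given by its upper-triangular
coefficients is positive definite if it is positive on all nonzero real vectors. -/
def QFPosDef {l : ℕ} (q : Fin l → Fin l → ℤ) : Prop :=
  ∀ x : Fin l → ℝ, x ≠ 0 → 0 < ∑ i, ∑ j, if i ≤ j then (q i j : ℝ) * x i * x j else 0

/-- The coefficients of the products `xᵢ xⱼ`, `i < j`, of a quaternary quadratic form. -/
structure EdgeWeights where
  (e01 e02 e12 e03 e13 e23 : ℤ)

/-- The spanning trees of the complete graph on four vertices. -/
def spanningTrees : List EdgeWeights :=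
  [⟨1, 1, 0, 1, 0, 0⟩, ⟨1, 1, 0, 0, 1, 0⟩, ⟨1, 1, 0, 0, 0, 1⟩, ⟨1, 0, 1, 1, 0, 0⟩,
   ⟨1, 0, 1, 0, 1, 0⟩, ⟨1, 0, 1, 0, 0, 1⟩, ⟨1, 0, 0, 1, 0, 1⟩, ⟨1, 0, 0, 0, 1, 1⟩,
   ⟨0, 1, 1, 1, 0, 0⟩, ⟨0, 1, 1, 0, 1, 0⟩, ⟨0, 1, 1, 0, 0, 1⟩, ⟨0, 1, 0, 1, 1, 0⟩,
   ⟨0, 1, 0, 0, 1, 1⟩, ⟨0, 0, 1, 1, 1, 0⟩, ⟨0, 0, 1, 1, 0, 1⟩, ⟨0, 0, 0, 1, 1, 1⟩]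

/-- The total absolute weight of the edges of `t`, where the edges are weighted by `o`. -/
def EdgeWeights.absWeight (t o : EdgeWeights) : ℤ :=
  t.e01 * o.e01.natAbs + t.e02 * o.e02.natAbs + t.e12 * o.e12.natAbs +
    t.e03 * o.e03.natAbs + t.e13 * o.e13.natAbs + t.e23 * o.e23.natAbs

/-- The edges of nonzero weight do not connect the four vertices. -/
def EdgeWeights.Disconnected (o : EdgeWeights) : Prop :=
  (o.e01 = 0 ∧ o.e02 = 0 ∧ o.e03 = 0) ∨ (o.e01 = 0 ∧ o.e12 = 0 ∧ o.e13 = 0) ∨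
  (o.e02 = 0 ∧ o.e12 = 0 ∧ o.e23 = 0) ∨ (o.e03 = 0 ∧ o.e13 = 0 ∧ o.e23 = 0) ∨
  (o.e02 = 0 ∧ o.e03 = 0 ∧ o.e12 = 0 ∧ o.e13 = 0) ∨
  (o.e01 = 0 ∧ o.e03 = 0 ∧ o.e12 = 0 ∧ o.e23 = 0) ∨
  (o.e01 = 0 ∧ o.e02 = 0 ∧ o.e13 = 0 ∧ o.e23 = 0)

instance (o : EdgeWeights) : Decidable o.Disconnected := by
  unfold EdgeWeights.Disconnected; infer_instance

/-- The determinant of the symmetric matrix with diagonal `a, b, c` and off-diagonal entries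
`u, v, w` at the positions `01, 02, 12`. -/
def gramDet (a b c u v w : ℤ) : ℤ :=
  a * b * c + 2 * u * v * w - a * (w * w) - b * (v * v) - c * (u * u)

/-- The value at `(o.e03, o.e13, o.e23)` of the adjugate form of the symmetric matrix with
diagonal `a, b, c` and off-diagonal entries `o.e01, o.e02, o.e12`. -/
def adjForm (a b c : ℤ) (o : EdgeWeights) : ℤ :=
  (b * c - (o.e12 * o.e12)) * (o.e03 * o.e03) + (a * c - (o.e02 * o.e02)) * (o.e13 * o.e13) +
    (a * b - (o.e01 * o.e01)) * (o.e23 * o.e23) + 2 * (o.e02 * o.e12 - o.e01 * c) * o.e03 * o.e13 +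
    2 * (o.e01 * o.e12 - b * o.e02) * o.e03 * o.e23 +
    2 * (o.e01 * o.e02 - a * o.e12) * o.e13 * o.e23

/-- The increment of the norm when `i e₀ + j e₁` is added to a vector having inner products
`v, w` with `e₀, e₁`. -/
def shift₂ (a b u v w i j : ℤ) : ℤ :=
  a * (i * i) + b * (j * j) + 2 * (u * i * j + v * i + w * j)

/-- The increment of the norm when `i e₀ + j e₁ + k e₂` is added to `e₃`. -/
def shift₃ (a b c : ℤ) (o : EdgeWeights) (i j k : ℤ) : ℤ :=
  a * (i * i) + b * (j * j) + c * (k * k) + 2 * (o.e01 * i * j + o.e02 * i * k + o.e12 * j * k +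
    o.e03 * i + o.e13 * j + o.e23 * k)

theorem small_reduced_check :
    ∀ d ∈ ([(2, 2, 2), (2, 2, 3), (2, 2, 4), (2, 3, 3), (2, 3, 4), (2, 4, 4), (3, 3, 3),
      (3, 3, 4), (3, 4, 4), (4, 4, 4)] : List (ℤ × ℤ × ℤ)),
    ∀ u ∈ ([0, 1, 2] : List ℤ), 2 * u ≤ d.1 →
    ∀ v ∈ ([0, 1, 2] : List ℤ), 2 * v ≤ d.1 →
    ∀ w ∈ ([-2, -1, 0, 1, 2] : List ℤ), -d.2.1 ≤ 2 * w → 2 * w ≤ d.2.1 →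
    (∀ i ∈ ([-1, 0, 1] : List ℤ), ∀ j ∈ ([-1, 0, 1] : List ℤ),
      0 ≤ shift₂ d.1 d.2.1 u v w i j) →
    4 ≤ gramDet d.1 d.2.1 d.2.2 u v w ∧
    (4 * (4 * (d.1 + d.2.1 + 2 * d.2.2) - 27) ≤
      gramDet d.1 d.2.1 d.2.2 u v w * (3 * d.2.2 - d.1 - d.2.1) ∨
    ∀ x ∈ ([0, 1, 2] : List ℤ), 2 * x ≤ d.1 →
    ∀ y ∈ ([-2, -1, 0, 1, 2] : List ℤ), -d.2.1 ≤ 2 * y → 2 * y ≤ d.2.1 →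
    ∀ z ∈ ([-2, -1, 0, 1, 2] : List ℤ), -d.2.2 ≤ 2 * z → 2 * z ≤ d.2.2 →
    (EdgeWeights.mk u v w x y z).Disconnected ∨
    (∃ t ∈ spanningTrees,
      4 * (d.1 + d.2.1 + 2 * d.2.2 - t.absWeight ⟨u, v, w, x, y, z⟩) ≤
        gramDet d.1 d.2.1 d.2.2 u v w * d.2.2 -
          adjForm d.1 d.2.1 d.2.2 ⟨u, v, w, x, y, z⟩ + 15) ∨
    (2 ∣ gramDet d.1 d.2.1 d.2.2 u v w ∧
      2 ∣ adjForm d.1 d.2.1 d.2.2 ⟨u, v, w, x, y, z⟩) ∨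
    ∃ i ∈ ([-1, 0, 1] : List ℤ), ∃ j ∈ ([-1, 0, 1] : List ℤ), ∃ k ∈ ([-1, 0, 1] : List ℤ),
      shift₃ d.1 d.2.1 d.2.2 ⟨u, v, w, x, y, z⟩ i j k < 0) := by
  decide +kernel

theorem exists_spanningTree {o : EdgeWeights} (h : ¬ o.Disconnected) :
    ∃ t ∈ spanningTrees, 3 ≤ t.absWeight o := by
  obtain ⟨u, v, w, x, y, z⟩ := o
  have pos : ∀ n : ℤ, n ≠ 0 → 1 ≤ (n.natAbs : ℤ) := fun n hn ↦ by omega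
  simp only [spanningTrees, EdgeWeights.absWeight, List.mem_cons,
    List.not_mem_nil, or_false, exists_eq_or_imp, exists_eq_left, one_mul, zero_mul, add_zero,
    zero_add]
  simp only [EdgeWeights.Disconnected] at h
  by_cases h₀ : u = 0 <;> by_cases h₁ : v = 0 <;> by_cases h₂ : w = 0 <;>
    by_cases h₃ : x = 0 <;> by_cases h₄ : y = 0 <;> by_cases h₅ : z = 0 <;>
    simp only [h₀, h₁, h₂, h₃, h₄, h₅, and_true, and_false, and_self, or_true, or_false,
      not_true_eq_false] at h <;>
    clear h <;> try have := pos _ h₀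
  all_goals try have := pos _ h₁
  all_goals try have := pos _ h₂
  all_goals try have := pos _ h₃
  all_goals try have := pos _ h₄
  all_goals try have := pos _ h₅
  all_goals omega

/-- Lagrange's diagonalisation of a quaternary quadratic form. -/
theorem lagrange_identity {a b c m u v w x y z d D E : ℝ} (hd : d = a * b - u ^ 2)
    (hD : D = a * b * c + 2 * u * v * w - a * w ^ 2 - b * v ^ 2 - c * u ^ 2)
    (hE : E = D * m - ((b * c - w ^ 2) * x ^ 2 + (a * c - v ^ 2) * y ^ 2 +
      (a * b - u ^ 2) * z ^ 2 + 2 * (v * w - u * c) * x * y + 2 * (u * w - b * v) * x * z +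
      2 * (u * v - a * w) * y * z))
    (ha₀ : a ≠ 0) (hd₀ : d ≠ 0) (hD₀ : D ≠ 0) (r s t q : ℝ) :
    a * r ^ 2 + b * s ^ 2 + c * t ^ 2 + m * q ^ 2 +
      2 * (u * r * s + v * r * t + w * s * t + x * r * q + y * s * q + z * t * q) =
    a * (r + (u / a * s + v / a * t + x / a * q)) ^ 2 +
      d / a * (s + ((a * w - u * v) / d * t + (a * y - u * x) / d * q)) ^ 2 +
      D / d * (t + ((a * b - u ^ 2) * z - (a * w - u * v) * y - (b * v - u * w) * x) / D * q) ^ 2 +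
      E / D * q ^ 2 := by
  have h₁ : b = (d + u ^ 2) / a := by rw [hd]; field_simp; ring
  have h₃ : m = (E + ((b * c - w ^ 2) * x ^ 2 + (a * c - v ^ 2) * y ^ 2 +
      (a * b - u ^ 2) * z ^ 2 + 2 * (v * w - u * c) * x * y + 2 * (u * w - b * v) * x * z +
      2 * (u * v - a * w) * y * z)) / D := by rw [hE]; field_simp; ring
  have h₂ : c = (D - 2 * u * v * w + a * w ^ 2 + b * v ^ 2) / d := by
    rw [hD, eq_div_iff hd₀, hd]; ring
  rw [h₃]
  clear hE h₃
  rw [h₂]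
  clear hD h₂
  rw [h₁]
  field_simp
  ring

theorem exists_int_add_sq_le (x : ℝ) : ∃ n : ℤ, (n + x) ^ 2 ≤ 1 / 4 := by
  refine ⟨-round x, ?_⟩
  have := abs_le.mp (abs_sub_round x)
  push_cast
  nlinarith

/-- In a basis whose third vector is shortest in its class modulo the first two, the third
Gram–Schmidt norm is bounded below. -/
theorem four_mul_gramDet_ge {a b c u v w : ℤ} (ha : 0 < a) (hd : 0 < a * b - u * u)
    (hD : 0 < gramDet a b c u v w) (h : ∀ i j, 0 ≤ shift₂ a b u v w i j) :
    (a * b - u * u) * (4 * c - a - b) ≤ 4 * gramDet a b c u v w := by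
  set d : ℝ := a * b - u ^ 2 with hd'
  set D : ℝ := a * b * c + 2 * u * v * w - a * w ^ 2 - b * v ^ 2 - c * u ^ 2 with hD'
  have ha₀ : (0 : ℝ) < a := by exact_mod_cast ha
  have hdR : ((a * b - u * u : ℤ) : ℝ) = d := by push_cast; ring
  have hDR : ((gramDet a b c u v w : ℤ) : ℝ) = D := by
    simp only [gramDet]; push_cast; ring
  have hd₀ : 0 < d := by rw [← hdR]; exact_mod_cast hd
  have hD₀ : 0 < D := by rw [← hDR]; exact_mod_cast hD
  obtain ⟨j, hj⟩ := exists_int_add_sq_le ((a * w - u * v) / d)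
  obtain ⟨i, hi⟩ := exists_int_add_sq_le (u / a * j + v / a)
  have key := lagrange_identity (m := 0) (x := 0) (y := 0) (z := 0) hd' hD' rfl ha₀.ne' hd₀.ne'
    hD₀.ne' i j 1 0
  have hs : (0 : ℝ) ≤ shift₂ a b u v w i j := by exact_mod_cast h i j
  simp only [shift₂] at hs
  push_cast at hs
  simp only [mul_one, mul_zero, add_zero, zero_pow, one_pow, ne_eq, OfNat.ofNat_ne_zero,
    not_false_eq_true] at key
  have hda : d / a ≤ b := by
    rw [div_le_iff₀ ha₀, hd']; nlinarith only [sq_nonneg (u : ℝ)]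
  have hda₀ : 0 < d / a := by positivity
  have h₁ := mul_le_mul_of_nonneg_left hi ha₀.le
  have h₂ := mul_le_mul_of_nonneg_left hj hda₀.le
  have h₃ : (c : ℝ) - (a + b) / 4 ≤ D / d * (1 + 0) ^ 2 := by linarith
  rw [add_zero, one_pow, mul_one, le_div_iff₀ hd₀] at h₃
  have : (((a * b - u * u) * (4 * c - a - b) : ℤ) : ℝ) ≤ ((4 * gramDet a b c u v w : ℤ) : ℝ) := by
    rw [Int.cast_mul, hdR, Int.cast_mul, hDR]
    push_cast
    linarith
  exact_mod_cast this

/-- In a basis whose fourth vector is shortest in its class modulo the first three, the fourth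
Gram–Schmidt norm is bounded below. -/
theorem four_mul_det_ge {a b c m : ℤ} {o : EdgeWeights} (ha : 0 < a)
    (hd : 0 < a * b - o.e01 * o.e01) (hD : 0 < gramDet a b c o.e01 o.e02 o.e12)
    (h : ∀ i j k, 0 ≤ shift₃ a b c o i j k) :
    gramDet a b c o.e01 o.e02 o.e12 * (4 * m - a - b - c) ≤
      4 * (gramDet a b c o.e01 o.e02 o.e12 * m - adjForm a b c o) := by
  obtain ⟨u, v, w, x, y, z⟩ := o
  dsimp only at *
  set d : ℝ := a * b - u ^ 2 with hd'
  set D : ℝ := a * b * c + 2 * u * v * w - a * w ^ 2 - b * v ^ 2 - c * u ^ 2 with hD'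
  set E : ℝ := D * m - ((b * c - w ^ 2) * x ^ 2 + (a * c - v ^ 2) * y ^ 2 +
      (a * b - u ^ 2) * z ^ 2 + 2 * (v * w - u * c) * x * y + 2 * (u * w - b * v) * x * z +
      2 * (u * v - a * w) * y * z) with hE'
  have ha₀ : (0 : ℝ) < a := by exact_mod_cast ha
  have hdR : ((a * b - u * u : ℤ) : ℝ) = d := by push_cast; ring
  have hDR : ((gramDet a b c u v w : ℤ) : ℝ) = D := by
    simp only [gramDet]; push_cast; ring
  have hER : ((gramDet a b c u v w * m - adjForm a b c ⟨u, v, w, x, y, z⟩ : ℤ) : ℝ) = E := by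
    rw [Int.cast_sub, Int.cast_mul, hDR, hE']
    simp only [adjForm]; push_cast; ring
  have hd₀ : 0 < d := by rw [← hdR]; exact_mod_cast hd
  have hD₀ : 0 < D := by rw [← hDR]; exact_mod_cast hD
  have key := lagrange_identity (m := m) hd' hD' hE' ha₀.ne' hd₀.ne' hD₀.ne'
  have key₂ := key 0 0 1 0
  obtain ⟨k, hk⟩ := exists_int_add_sq_le
    (((a * b - u ^ 2) * z - (a * w - u * v) * y - (b * v - u * w) * x) / D)
  obtain ⟨j, hj⟩ := exists_int_add_sq_le ((a * w - u * v) / d * k + (a * y - u * x) / d)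
  obtain ⟨i, hi⟩ := exists_int_add_sq_le (u / a * j + v / a * k + x / a)
  replace key := key i j k 1
  have hs : (0 : ℝ) ≤ shift₃ a b c ⟨u, v, w, x, y, z⟩ i j k := by exact_mod_cast h i j k
  simp only [shift₃] at hs
  push_cast at hs
  simp only [mul_one, one_pow] at key
  simp only [mul_one, mul_zero, add_zero, zero_add, zero_pow, one_pow, ne_eq,
    OfNat.ofNat_ne_zero, not_false_eq_true] at key₂
  have hda : d / a ≤ b := by
    rw [div_le_iff₀ ha₀, hd']; nlinarith only [sq_nonneg (u : ℝ)]
  have hda₀ : 0 < d / a := by positivity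
  have hDd₀ : 0 < D / d := by positivity
  have hDd : D / d ≤ c := by
    clear key
    have p₁ : 0 ≤ a * ((v : ℝ) / a) ^ 2 := by positivity
    have p₂ : 0 ≤ d / a * (((a : ℝ) * w - u * v) / d) ^ 2 := by positivity
    linarith
  have h₁ := mul_le_mul_of_nonneg_left hi ha₀.le
  have h₂ := mul_le_mul_of_nonneg_left hj hda₀.le
  have h₃ := mul_le_mul_of_nonneg_left hk hDd₀.le
  have h₄ : (m : ℝ) - (a + b + c) / 4 ≤ E / D := by
    generalize a * (i + _ : ℝ) ^ 2 = P₁ at key h₁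
    generalize d / a * (j + _ : ℝ) ^ 2 = P₂ at key h₂
    generalize D / d * (k + _ : ℝ) ^ 2 = P₃ at key h₃
    clear_value E D d
    linarith only [key, hs, h₁, h₂, h₃, hda, hDd]
  rw [le_div_iff₀ hD₀] at h₄
  have : ((gramDet a b c u v w * (4 * m - a - b - c) : ℤ) : ℝ) ≤
      ((4 * (gramDet a b c u v w * m - adjForm a b c ⟨u, v, w, x, y, z⟩) : ℤ) : ℝ) := by
    rw [Int.cast_mul, hDR, Int.cast_mul, hER]
    push_cast
    linarith
  exact_mod_cast this

theorem large_diagonal_bound {a b c : ℤ} (ha : 2 ≤ a) (hab : a ≤ b) (hbc : b ≤ c)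
    (h : (a, b, c) ∉ ([(2, 2, 2), (2, 2, 3), (2, 2, 4), (2, 3, 3), (2, 3, 4), (2, 4, 4),
      (3, 3, 3), (3, 3, 4), (3, 4, 4), (4, 4, 4)] : List (ℤ × ℤ × ℤ))) :
    64 ≤ a * (4 * b - a) * (4 * c - a - b) ∧
      64 * (4 * (a + b + 2 * c) - 27) ≤
        a * (4 * b - a) * (4 * c - a - b) * (3 * c - a - b) := by
  simp only [List.mem_cons, Prod.mk.injEq, List.not_mem_nil, or_false, not_or] at h
  obtain ⟨i, rfl⟩ : ∃ i, b = a + i := ⟨b - a, by ring⟩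
  obtain ⟨j, rfl⟩ : ∃ j, c = a + i + j := ⟨c - (a + i), by ring⟩
  have hi : 0 ≤ i := by linarith
  have hj : 0 ≤ j := by linarith
  have cases_le : 5 ≤ a ∨ (a = 4 ∧ 1 ≤ i) ∨ (a = 4 ∧ i = 0 ∧ 1 ≤ j) ∨ (a = 3 ∧ 2 ≤ i) ∨
      (a = 3 ∧ i = 1 ∧ 1 ≤ j) ∨ (a = 3 ∧ i = 0 ∧ 2 ≤ j) ∨ (a = 2 ∧ 3 ≤ i) ∨
      (a = 2 ∧ i = 2 ∧ 1 ≤ j) ∨ (a = 2 ∧ i = 1 ∧ 2 ≤ j) ∨ (a = 2 ∧ i = 0 ∧ 3 ≤ j) := by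
    rcases le_or_gt 5 a with h5 | h5
    · exact Or.inl h5
    · interval_cases a <;> norm_num at h ⊢ <;> omega
  have lift : ∀ {n k : ℤ}, n ≤ k → ∃ l, 0 ≤ l ∧ k = n + l :=
    fun {n k} hk ↦ ⟨k - n, by linarith, by ring⟩
  clear h hab hbc
  rcases cases_le with h | ⟨rfl, h⟩ | ⟨rfl, rfl, h⟩ | ⟨rfl, h⟩ | ⟨rfl, rfl, h⟩ | ⟨rfl, rfl, h⟩ |
    ⟨rfl, h⟩ | ⟨rfl, rfl, h⟩ | ⟨rfl, rfl, h⟩ | ⟨rfl, rfl, h⟩ <;>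
  obtain ⟨l, hl, rfl⟩ := lift h <;>
  constructor <;> rw [← sub_nonneg] <;> ring_nf <;> positivity

/-- A connected reduced quaternary Gram matrix of odd determinant has a spanning tree of large
weight relative to its trace and determinant. -/
theorem exists_spanningTree_bound {a b c m : ℤ} {o : EdgeWeights} (ha : 0 < a) (hab : a ≤ b)
    (hbc : b ≤ c) (hcm : c ≤ m) (hd : 0 < a * b - o.e01 * o.e01)
    (hD : 0 < gramDet a b c o.e01 o.e02 o.e12) (hu : 0 ≤ o.e01) (hv : 0 ≤ o.e02)
    (hx : 0 ≤ o.e03) (hua : 2 * o.e01 ≤ a)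
    (h₂ : ∀ i j, 0 ≤ shift₂ a b o.e01 o.e02 o.e12 i j) (h₃ : ∀ i j k, 0 ≤ shift₃ a b c o i j k)
    (ho : ¬ o.Disconnected)
    (hodd : ¬ 2 ∣ gramDet a b c o.e01 o.e02 o.e12 * m - adjForm a b c o) :
    ∃ t ∈ spanningTrees, 4 * (a + b + c + m - t.absWeight o) ≤
      gramDet a b c o.e01 o.e02 o.e12 * m - adjForm a b c o + 15 := by
  have hDge := four_mul_gramDet_ge ha hd hD h₂
  have hEge := four_mul_det_ge (m := m) ha hd hD h₃
  have hva : 2 * o.e02 ≤ a := by have := h₂ (-1) 0; simp only [shift₂] at this; linarith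
  have hxa : 2 * o.e03 ≤ a := by have := h₃ (-1) 0 0; simp only [shift₃] at this; linarith
  have hwb : 2 * o.e12 ≤ b := by have := h₂ 0 (-1); simp only [shift₂] at this; linarith
  have hwb' : -b ≤ 2 * o.e12 := by have := h₂ 0 1; simp only [shift₂] at this; linarith
  have hyb : 2 * o.e13 ≤ b := by have := h₃ 0 (-1) 0; simp only [shift₃] at this; linarith
  have hyb' : -b ≤ 2 * o.e13 := by have := h₃ 0 1 0; simp only [shift₃] at this; linarith
  have hzc : 2 * o.e23 ≤ c := by have := h₃ 0 0 (-1); simp only [shift₃] at this; linarith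
  have hzc' : -c ≤ 2 * o.e23 := by have := h₃ 0 0 1; simp only [shift₃] at this; linarith
  have ha₂ : 2 ≤ a := by
    by_contra! ha₂
    exact ho (Or.inl ⟨by omega, by omega, by omega⟩)
  have large : 4 ≤ gramDet a b c o.e01 o.e02 o.e12 →
      4 * (4 * (a + b + 2 * c) - 27) ≤ gramDet a b c o.e01 o.e02 o.e12 * (3 * c - a - b) →
      ∃ t ∈ spanningTrees, 4 * (a + b + c + m - t.absWeight o) ≤
        gramDet a b c o.e01 o.e02 o.e12 * m - adjForm a b c o + 15 := by
    intro hD₄ hlarge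
    obtain ⟨t, ht, hto⟩ := exists_spanningTree ho
    exact ⟨t, ht, by nlinarith only [mul_nonneg (sub_nonneg.2 hD₄) (sub_nonneg.2 hcm), hto,
      hEge, hlarge]⟩
  by_cases hmem : (a, b, c) ∈ ([(2, 2, 2), (2, 2, 3), (2, 2, 4), (2, 3, 3), (2, 3, 4),
      (2, 4, 4), (3, 3, 3), (3, 3, 4), (3, 4, 4), (4, 4, 4)] : List (ℤ × ℤ × ℤ))
  · have hb₄ : a ≤ 4 ∧ b ≤ 4 ∧ c ≤ 4 := by
      simp only [List.mem_cons, Prod.mk.injEq, List.not_mem_nil, or_false] at hmem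
      omega
    obtain ⟨u, v, w, x, y, z⟩ := o
    dsimp only at *
    have mem₃ : ∀ n : ℤ, 0 ≤ n → n ≤ 2 → n ∈ ([0, 1, 2] : List ℤ) := fun n _ _ ↦ by
      simp only [List.mem_cons, List.not_mem_nil, or_false]; omega
    have mem₅ : ∀ n : ℤ, -2 ≤ n → n ≤ 2 → n ∈ ([-2, -1, 0, 1, 2] : List ℤ) := fun n _ _ ↦ by
      simp only [List.mem_cons, List.not_mem_nil, or_false]; omega
    obtain ⟨hD₄, h | h⟩ := small_reduced_check (a, b, c) hmem u (mem₃ u hu (by omega)) hua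
      v (mem₃ v hv (by omega)) hva w (mem₅ w (by omega) (by omega)) hwb' hwb
      (fun i _ j _ ↦ h₂ i j)
    · exact large hD₄ h
    rcases h x (mem₃ x hx (by omega)) hxa y (mem₅ y (by omega) (by omega)) hyb' hyb
      z (mem₅ z (by omega) (by omega)) hzc' hzc with h | ⟨t, ht, h⟩ | ⟨h, h'⟩ |
      ⟨i, -, j, -, k, -, h⟩
    · exact absurd h ho
    · exact ⟨t, ht, by
        dsimp only at *
        nlinarith only [mul_nonneg (sub_nonneg.2 hD₄) (sub_nonneg.2 hcm), h]⟩
    · exact absurd (dvd_sub (h.mul_right m) h') hodd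
    · exact absurd (h₃ i j k) (not_le.2 h)
  · obtain ⟨h₁, h₂⟩ := large_diagonal_bound ha₂ hab hbc hmem
    have hpos : 0 ≤ 4 * c - a - b := by linarith
    have hD₁ : a * (4 * b - a) * (4 * c - a - b) ≤
        16 * gramDet a b c o.e01 o.e02 o.e12 := by
      have : a * (4 * b - a) ≤ 4 * (a * b - o.e01 * o.e01) := by nlinarith only [hu, hua]
      nlinarith only [mul_le_mul_of_nonneg_right this hpos, hDge]
    refine large (by linarith) ?_
    have := mul_le_mul_of_nonneg_right hD₁ (show 0 ≤ 3 * c - a - b by linarith)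
    linarith

/-- The upper triangular coefficients of `Σ xᵢ² + Σ_{i < j} sᵢⱼ xᵢ xⱼ`. -/
def EdgeWeights.form (s : EdgeWeights) : Fin 4 → Fin 4 → ℤ :=
  ![![1, s.e01, s.e02, s.e03], ![0, 1, s.e12, s.e13], ![0, 0, 1, s.e23], ![0, 0, 0, 1]]

theorem EdgeWeights.form_posDef {s : EdgeWeights} (h₁ : 0 < 2 * 2 - s.e01 * s.e01)
    (h₂ : 0 < gramDet 2 2 2 s.e01 s.e02 s.e12)
    (h₃ : 0 < gramDet 2 2 2 s.e01 s.e02 s.e12 * 2 - adjForm 2 2 2 s) : QFPosDef s.form := by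
  obtain ⟨u, v, w, x, y, z⟩ := s
  dsimp only at *
  set d : ℝ := 2 * 2 - u ^ 2 with hd'
  set D : ℝ := 2 * 2 * 2 + 2 * u * v * w - 2 * w ^ 2 - 2 * v ^ 2 - 2 * u ^ 2 with hD'
  set E : ℝ := D * 2 - ((2 * 2 - w ^ 2) * x ^ 2 + (2 * 2 - v ^ 2) * y ^ 2 +
      (2 * 2 - u ^ 2) * z ^ 2 + 2 * (v * w - u * 2) * x * y + 2 * (u * w - 2 * v) * x * z +
      2 * (u * v - 2 * w) * y * z) with hE'
  have hdR : ((2 * 2 - u * u : ℤ) : ℝ) = d := by push_cast; ring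
  have hDR : ((gramDet 2 2 2 u v w : ℤ) : ℝ) = D := by
    simp only [gramDet]; push_cast; ring
  have hER : ((gramDet 2 2 2 u v w * 2 - adjForm 2 2 2 ⟨u, v, w, x, y, z⟩ : ℤ) : ℝ) = E := by
    rw [Int.cast_sub, Int.cast_mul, hDR, hE']
    simp only [adjForm]; push_cast; ring
  have hd₀ : 0 < d := by rw [← hdR]; exact_mod_cast h₁
  have hD₀ : 0 < D := by rw [← hDR]; exact_mod_cast h₂
  have hE₀ : 0 < E := by rw [← hER]; exact_mod_cast h₃
  intro r hr
  have key := lagrange_identity hd' hD' hE' two_ne_zero hd₀.ne' hD₀.ne' (r 0) (r 1) (r 2) (r 3)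
  have hsum : (∑ i, ∑ j, if i ≤ j then
      ((EdgeWeights.form ⟨u, v, w, x, y, z⟩ i j : ℤ) : ℝ) * r i * r j else 0) =
      (2 * r 0 ^ 2 + 2 * r 1 ^ 2 + 2 * r 2 ^ 2 + 2 * r 3 ^ 2 +
        2 * (u * r 0 * r 1 + v * r 0 * r 2 + w * r 1 * r 2 + x * r 0 * r 3 + y * r 1 * r 3 +
          z * r 2 * r 3)) / 2 := by
    simp [Fin.sum_univ_four, EdgeWeights.form]
    ring
  rw [hsum, key]
  refine div_pos ?_ two_pos
  by_cases h3 : r 3 = 0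
  · by_cases h2 : r 2 = 0
    · by_cases h1 : r 1 = 0
      · have h0 : r 0 ≠ 0 := fun h0 ↦ hr (funext fun i ↦ by fin_cases i <;> assumption)
        simp only [h1, h2, h3, mul_zero, add_zero]
        positivity
      · simp only [h2, h3, mul_zero, add_zero]
        positivity
    · simp only [h3, mul_zero, add_zero]
      positivity
  · positivity

theorem spanningTrees_form_minors :
    ∀ t ∈ spanningTrees, ∀ s₀ ∈ (if t.e01 = 0 then [0] else [-1, 0, 1] : List ℤ),
    ∀ s₁ ∈ (if t.e02 = 0 then [0] else [-1, 0, 1] : List ℤ),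
    ∀ s₂ ∈ (if t.e12 = 0 then [0] else [-1, 0, 1] : List ℤ),
    ∀ s₃ ∈ (if t.e03 = 0 then [0] else [-1, 0, 1] : List ℤ),
    ∀ s₄ ∈ (if t.e13 = 0 then [0] else [-1, 0, 1] : List ℤ),
    ∀ s₅ ∈ (if t.e23 = 0 then [0] else [-1, 0, 1] : List ℤ),
    0 < 2 * 2 - s₀ * s₀ ∧ 0 < gramDet 2 2 2 s₀ s₁ s₂ ∧
      0 < gramDet 2 2 2 s₀ s₁ s₂ * 2 - adjForm 2 2 2 ⟨s₀, s₁, s₂, s₃, s₄, s₅⟩ := by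
  decide +kernel

theorem exists_posDef_form_of_spanningTree {t : EdgeWeights} (ht : t ∈ spanningTrees)
    (o : EdgeWeights) : ∃ s : EdgeWeights, QFPosDef s.form ∧
      s.e01 * o.e01 + s.e02 * o.e02 + s.e12 * o.e12 + s.e03 * o.e03 + s.e13 * o.e13 +
        s.e23 * o.e23 = -t.absWeight o := by
  have mem : ∀ e n : ℤ, e = 0 ∨ e = 1 →
      -e * n.sign ∈ (if e = 0 then [0] else [-1, 0, 1] : List ℤ) := by
    rintro e n (rfl | rfl)
    · simp
    · rcases Int.sign_trichotomy n with h | h | h <;> simp [h]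
  have h01 : ∀ t ∈ spanningTrees, (t.e01 = 0 ∨ t.e01 = 1) ∧ (t.e02 = 0 ∨ t.e02 = 1) ∧
      (t.e12 = 0 ∨ t.e12 = 1) ∧ (t.e03 = 0 ∨ t.e03 = 1) ∧ (t.e13 = 0 ∨ t.e13 = 1) ∧
      (t.e23 = 0 ∨ t.e23 = 1) := by
    decide +kernel
  obtain ⟨h₀, h₁, h₂, h₃, h₄, h₅⟩ := h01 t ht
  obtain ⟨k₁, k₂, k₃⟩ := spanningTrees_form_minors t ht _ (mem _ o.e01 h₀) _ (mem _ o.e02 h₁)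
    _ (mem _ o.e12 h₂) _ (mem _ o.e03 h₃) _ (mem _ o.e13 h₄) _ (mem _ o.e23 h₅)
  refine ⟨⟨-t.e01 * o.e01.sign, -t.e02 * o.e02.sign, -t.e12 * o.e12.sign,
    -t.e03 * o.e03.sign, -t.e13 * o.e13.sign, -t.e23 * o.e23.sign⟩,
    EdgeWeights.form_posDef k₁ k₂ k₃, ?_⟩
  have abs_eq : ∀ e n : ℤ, -e * n.sign * n = -(e * n.natAbs) := fun e n ↦ by
    rw [mul_assoc, Int.sign_mul_self, neg_mul]
  simp only [EdgeWeights.absWeight, abs_eq]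
  ring

theorem MatrixEquiv.congr_right {l : ℕ} {A C T : Matrix (Fin l) (Fin l) ℤ}
    (h : MatrixEquiv A C) (hT : IsUnit T.det) : MatrixEquiv A (Tᵀ * C * T) := by
  obtain ⟨S, hS, rfl⟩ := h
  refine ⟨T⁻¹ * S, ?_, ?_⟩
  · rw [Matrix.det_mul]
    exact (Matrix.isUnit_nonsing_inv_det T hT).mul hS
  · have h₁ : T * (T⁻¹ * S) = S := by rw [← Matrix.mul_assoc, Matrix.mul_nonsing_inv T hT, one_mul]
    have h₂ : (T⁻¹ * S)ᵀ * Tᵀ = Sᵀ := by rw [← Matrix.transpose_mul, h₁]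
    calc Sᵀ * C * S = ((T⁻¹ * S)ᵀ * Tᵀ) * C * (T * (T⁻¹ * S)) := by rw [h₁, h₂]
      _ = _ := by simp only [Matrix.mul_assoc]

theorem IntPosDef.congr {l : ℕ} {C T : Matrix (Fin l) (Fin l) ℤ}
    (h : IntPosDef C) (hT : IsUnit T.det) : IntPosDef (Tᵀ * C * T) := by
  have form_eq : ∀ (M : Matrix (Fin l) (Fin l) ℤ) (x : Fin l → ℝ),
      ∑ i, ∑ j, x i * (M i j : ℝ) * x j = x ⬝ᵥ (M.map (Int.castRingHom ℝ)) *ᵥ x := by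
    intro M x
    simp only [dotProduct, Matrix.mulVec, Finset.mul_sum, Matrix.map_apply, mul_assoc]
    rfl
  have hdet : IsUnit (T.map (Int.castRingHom ℝ)).det := by
    have := hT.map (Int.castRingHom ℝ)
    rwa [RingHom.map_det] at this
  intro x hx
  have hTx : (T.map (Int.castRingHom ℝ)) *ᵥ x ≠ 0 := fun h₀ ↦
    hx ((Matrix.mulVec_injective_iff_isUnit.2 ((Matrix.isUnit_iff_isUnit_det _).2 hdet))
      (h₀.trans (Matrix.mulVec_zero _).symm))
  have := h _ hTx
  rw [form_eq] at this ⊢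
  rw [Matrix.map_mul, Matrix.map_mul, Matrix.transpose_map, ← Matrix.mulVec_mulVec,
    ← Matrix.mulVec_mulVec, Matrix.dotProduct_mulVec, Matrix.vecMul_transpose]
  exact this

/-- No Gram matrix in the class of `C` has smaller trace than `C`. -/
def IsTraceMinimal {l : ℕ} (C : Matrix (Fin l) (Fin l) ℤ) : Prop :=
  ∀ T : Matrix (Fin l) (Fin l) ℤ, IsUnit T.det → C.trace ≤ (Tᵀ * C * T).trace

theorem IsTraceMinimal.congr {l : ℕ} {C T : Matrix (Fin l) (Fin l) ℤ} (h : IsTraceMinimal C)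
    (hT : IsUnit T.det) (htr : (Tᵀ * C * T).trace = C.trace) : IsTraceMinimal (Tᵀ * C * T) := by
  intro U hU
  have := h (T * U) (by rw [Matrix.det_mul]; exact hT.mul hU)
  rw [htr]
  simpa only [Matrix.transpose_mul, Matrix.mul_assoc] using this

theorem IntPosDef.trace_nonneg {l : ℕ} {C : Matrix (Fin l) (Fin l) ℤ} (h : IntPosDef C) :
    0 ≤ C.trace := by
  refine Finset.sum_nonneg fun i _ ↦ ?_
  have := h (Pi.single i 1) (by simp)
  simp only [Pi.single_apply, ite_mul, one_mul, zero_mul, mul_ite, mul_one, mul_zero,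
    Finset.sum_ite_eq', Finset.mem_univ, if_true] at this
  exact_mod_cast this.le

theorem exists_isTraceMinimal {l : ℕ} {A : Matrix (Fin l) (Fin l) ℤ} (hA : IntPosDef A) :
    ∃ S : Matrix (Fin l) (Fin l) ℤ, IsUnit S.det ∧ IsTraceMinimal (Sᵀ * A * S) := by
  obtain ⟨S, hS, hmin⟩ := (measure fun S : Matrix (Fin l) (Fin l) ℤ ↦
    (Sᵀ * A * S).trace.toNat).wf.has_min {S | IsUnit S.det} ⟨1, by simp⟩
  refine ⟨S, hS, fun T hT ↦ ?_⟩
  have hST : IsUnit (S * T).det := by rw [Matrix.det_mul]; exact IsUnit.mul hS hT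
  have h₁ := hmin (S * T) hST
  have h₂ := (hA.congr hST).trace_nonneg
  have h₃ : Tᵀ * (Sᵀ * A * S) * T = (S * T)ᵀ * A * (S * T) := by
    simp only [Matrix.transpose_mul, Matrix.mul_assoc]
  change ¬ ((S * T)ᵀ * A * (S * T)).trace.toNat < (Sᵀ * A * S).trace.toNat at h₁
  rw [h₃]
  omega

theorem exists_reduced {A : Matrix (Fin 4) (Fin 4) ℤ} (hA : IntPosDef A) :
    ∃ S : Matrix (Fin 4) (Fin 4) ℤ, IsUnit S.det ∧ IsTraceMinimal (Sᵀ * A * S) ∧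
      Monotone (fun i ↦ (Sᵀ * A * S) i i) ∧ ∀ i, 0 ≤ (Sᵀ * A * S) 0 i := by
  obtain ⟨S, hS, hmin⟩ := exists_isTraceMinimal hA
  set C := Sᵀ * A * S with hC
  let σ := Tuple.sort fun i ↦ C i i
  have hσ : Monotone fun i ↦ C (σ i) (σ i) := Tuple.monotone_sort fun i ↦ C i i
  let e : Fin 4 → ℤ := fun i ↦ if i = 0 ∨ 0 ≤ C (σ 0) (σ i) then 1 else -1
  have he : ∀ i, e i * e i = 1 := fun i ↦ by dsimp only [e]; split_ifs <;> rfl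
  let T : Matrix (Fin 4) (Fin 4) ℤ := (1 : Matrix (Fin 4) (Fin 4) ℤ).submatrix id σ * diagonal e
  have hentry : ∀ i j, (Tᵀ * C * T) i j = e i * C (σ i) (σ j) * e j := by
    intro i j
    have h₁ : ((1 : Matrix (Fin 4) (Fin 4) ℤ).submatrix id σ)ᵀ * C *
        (1 : Matrix (Fin 4) (Fin 4) ℤ).submatrix id σ = C.submatrix σ σ := by
      ext i j
      simp [Matrix.mul_apply, Matrix.one_apply]
    have h₂ : Tᵀ * C * T = diagonal e * C.submatrix σ σ * diagonal e := by
      rw [← h₁]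
      simp only [T, Matrix.transpose_mul, Matrix.diagonal_transpose, Matrix.mul_assoc]
    rw [h₂, Matrix.mul_diagonal, Matrix.diagonal_mul, Matrix.submatrix_apply]
  have hdiag : ∀ i, (Tᵀ * C * T) i i = C (σ i) (σ i) := fun i ↦ by
    rw [hentry, mul_right_comm, he, one_mul]
  have hT : IsUnit T.det := by
    rw [Matrix.det_mul, Matrix.det_diagonal]
    refine IsUnit.mul ?_ (IsUnit.of_mul_eq_one (∏ i, e i) ?_)
    · rw [Matrix.det_permute']
      simp
    · rw [← Finset.prod_mul_distrib]
      exact Finset.prod_eq_one fun i _ ↦ he i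
  have htr : (Tᵀ * C * T).trace = C.trace := by
    simp only [Matrix.trace, Matrix.diag, hdiag]
    exact Equiv.sum_comp σ fun i ↦ C i i
  have hST : (S * T)ᵀ * A * (S * T) = Tᵀ * C * T := by
    simp only [hC, Matrix.transpose_mul, Matrix.mul_assoc]
  refine ⟨S * T, by rw [Matrix.det_mul]; exact hS.mul hT, ?_⟩
  rw [hST]
  refine ⟨hmin.congr hT htr, ?_, fun i ↦ ?_⟩
  · simpa only [hdiag] using hσ
  · by_cases hi : i = 0
    · subst hi
      have := (hA.congr hS) (Pi.single (σ 0) 1) (by simp)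
      simp only [Pi.single_apply, ite_mul, one_mul, zero_mul, mul_ite, mul_one, mul_zero,
        Finset.sum_ite_eq', Finset.mem_univ, if_true] at this
      rw [hdiag]
      exact_mod_cast this.le
    · rw [hentry]
      have h₀ : e 0 = 1 := if_pos (Or.inl rfl)
      rw [h₀, one_mul]
      dsimp only [e]
      split_ifs with h
      · simpa [hi] using h
      · have := not_or.1 h
        linarith [this.2]

/-- The symmetric matrix with diagonal `a, b, c, m` and off-diagonal entries `o`. -/
def EdgeWeights.gram (a b c m : ℤ) (o : EdgeWeights) : Matrix (Fin 4) (Fin 4) ℤ :=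
  !![a, o.e01, o.e02, o.e03; o.e01, b, o.e12, o.e13; o.e02, o.e12, c, o.e23;
    o.e03, o.e13, o.e23, m]

theorem EdgeWeights.exists_eq_gram {C : Matrix (Fin 4) (Fin 4) ℤ} (hC : Cᵀ = C) :
    ∃ a b c m o, C = EdgeWeights.gram a b c m o := by
  have h : ∀ i j, C i j = C j i := fun i j ↦ congrFun (congrFun hC j) i
  refine ⟨C 0 0, C 1 1, C 2 2, C 3 3, ⟨C 0 1, C 0 2, C 1 2, C 0 3, C 1 3, C 2 3⟩, ?_⟩
  ext i j
  fin_cases i <;> fin_cases j <;> first | rfl | exact h _ _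

theorem EdgeWeights.det_gram (a b c m : ℤ) (o : EdgeWeights) :
    (EdgeWeights.gram a b c m o).det =
      gramDet a b c o.e01 o.e02 o.e12 * m - adjForm a b c o := by
  simp [EdgeWeights.gram, Matrix.det_succ_row_zero, Fin.sum_univ_succ, gramDet, adjForm,
    Fin.succAbove]
  ring

theorem EdgeWeights.decomposable_gram {a b c m : ℤ} {o : EdgeWeights} (ho : o.Disconnected) :
    Decomposable (EdgeWeights.gram a b c m o) := by
  rcases ho with h | h | h | h | h | h | h
  · refine ⟨1, 1, by norm_num, by norm_num, fun i j hi hj ↦ ?_⟩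
    fin_cases i <;> fin_cases j <;> simp_all [EdgeWeights.gram]
  · refine ⟨Equiv.swap 0 1, 1, by norm_num, by norm_num, fun i j hi hj ↦ ?_⟩
    fin_cases i <;> fin_cases j <;> simp_all [EdgeWeights.gram, Equiv.swap_apply_def]
  · refine ⟨Equiv.swap 0 2, 1, by norm_num, by norm_num, fun i j hi hj ↦ ?_⟩
    fin_cases i <;> fin_cases j <;> simp_all [EdgeWeights.gram, Equiv.swap_apply_def]
  · refine ⟨1, 3, by norm_num, by norm_num, fun i j hi hj ↦ ?_⟩
    fin_cases i <;> fin_cases j <;> simp_all [EdgeWeights.gram]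
  · refine ⟨1, 2, by norm_num, by norm_num, fun i j hi hj ↦ ?_⟩
    fin_cases i <;> fin_cases j <;> simp_all [EdgeWeights.gram]
  · refine ⟨Equiv.swap 1 2, 2, by norm_num, by norm_num, fun i j hi hj ↦ ?_⟩
    fin_cases i <;> fin_cases j <;> simp_all [EdgeWeights.gram, Equiv.swap_apply_def]
  · refine ⟨Equiv.swap 1 3, 2, by norm_num, by norm_num, fun i j hi hj ↦ ?_⟩
    fin_cases i <;> fin_cases j <;> simp_all [EdgeWeights.gram, Equiv.swap_apply_def]

theorem IsTraceMinimal.gram_shift_nonneg {a b c m : ℤ} {o : EdgeWeights}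
    (h : IsTraceMinimal (EdgeWeights.gram a b c m o)) :
    (∀ i, 0 ≤ a * (i * i) + 2 * o.e01 * i) ∧
      (∀ i j, 0 ≤ shift₂ a b o.e01 o.e02 o.e12 i j) ∧ ∀ i j k, 0 ≤ shift₃ a b c o i j k := by
  refine ⟨fun i ↦ ?_, fun i j ↦ ?_, fun i j k ↦ ?_⟩
  · have := h !![1, i, 0, 0; 0, 1, 0, 0; 0, 0, 1, 0; 0, 0, 0, 1]
      (by simp [Matrix.det_succ_row_zero, Fin.sum_univ_succ, Fin.succAbove])
    simp [EdgeWeights.gram, Matrix.trace, Fin.sum_univ_succ, Matrix.mul_apply] at this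
    linarith
  · have := h !![1, 0, i, 0; 0, 1, j, 0; 0, 0, 1, 0; 0, 0, 0, 1]
      (by simp [Matrix.det_succ_row_zero, Fin.sum_univ_succ, Fin.succAbove])
    simp [EdgeWeights.gram, Matrix.trace, Fin.sum_univ_succ, Matrix.mul_apply] at this
    simp only [shift₂]
    linarith
  · have := h !![1, 0, 0, i; 0, 1, 0, j; 0, 0, 1, k; 0, 0, 0, 1]
      (by simp [Matrix.det_succ_row_zero, Fin.sum_univ_succ, Fin.succAbove])
    simp [EdgeWeights.gram, Matrix.trace, Fin.sum_univ_succ, Matrix.mul_apply] at this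
    simp only [shift₃]
    linarith

theorem IntPosDef.gram_minors_pos {a b c m : ℤ} {o : EdgeWeights}
    (h : IntPosDef (EdgeWeights.gram a b c m o)) :
    0 < a ∧ 0 < a * b - o.e01 * o.e01 ∧ 0 < gramDet a b c o.e01 o.e02 o.e12 := by
  obtain ⟨u, v, w, x, y, z⟩ := o
  have value : ∀ r s t : ℤ, ¬ (r = 0 ∧ s = 0 ∧ t = 0) →
      0 < a * r ^ 2 + b * s ^ 2 + c * t ^ 2 + 2 * (u * r * s + v * r * t + w * s * t) := by
    intro r s t hrst
    have := h ![r, s, t, 0] fun h₀ ↦ hrst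
      ⟨by simpa using congrFun h₀ 0, by simpa using congrFun h₀ 1, by simpa using congrFun h₀ 2⟩
    simp [Fin.sum_univ_four, EdgeWeights.gram] at this
    have h' : (0 : ℝ) < ((a * r ^ 2 + b * s ^ 2 + c * t ^ 2 +
        2 * (u * r * s + v * r * t + w * s * t) : ℤ) : ℝ) := by
      push_cast
      linarith
    exact_mod_cast h'
  have ha : 0 < a := by simpa using value 1 0 0 (by simp)
  have hd : 0 < a * b - u * u := by
    have := value (-u) a 0 (by simp [ha.ne'])
    refine pos_of_mul_pos_right (b := a * b - u * u) (a := a) ?_ ha.le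
    linarith
  refine ⟨ha, hd, ?_⟩
  have := value (u * w - b * v) (u * v - a * w) (a * b - u * u) (by simp [hd.ne'])
  refine pos_of_mul_pos_right (a := a * b - u * u) ?_ hd.le
  simp only [gramDet]
  linarith

/-- Let `q = p^d` with `p` an odd prime and let `A` be a symmetric positive
definite `4 × 4` integer matrix with `det A = q`, not equivalent to any decomposable matrix.
Then there are a symmetric matrix `(c_{ij})` equivalent to `A` and a positive definite
integral quadratic form `Σ_{i ≤ j} q_{ij} x_i x_j` with `4 Σ_{i ≤ j} q_{ij} c_{ij} ≤ q + 15`. -/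
theorem stmt5 (p : ℕ) (hp : p.Prime) (hodd : p ≠ 2) (d : ℕ)
    (A : Matrix (Fin 4) (Fin 4) ℤ) (hsymm : Aᵀ = A) (hpos : IntPosDef A)
    (hdet : A.det = (p : ℤ) ^ d)
    (hdec : ¬ ∃ D : Matrix (Fin 4) (Fin 4) ℤ, Decomposable D ∧ MatrixEquiv A D) :
    ∃ C : Matrix (Fin 4) (Fin 4) ℤ, ∃ q : Fin 4 → Fin 4 → ℤ,
      MatrixEquiv A C ∧ Cᵀ = C ∧ QFPosDef q ∧
      4 * (∑ i, ∑ j, if i ≤ j then q i j * C i j else 0) ≤ (p : ℤ) ^ d + 15 := by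
  obtain ⟨S, hS, hmin, hmono, hnonneg⟩ := exists_reduced hpos
  have hequiv : MatrixEquiv A (Sᵀ * A * S) :=
    MatrixEquiv.congr_right ⟨1, by simp, by simp⟩ hS
  have hCsymm : (Sᵀ * A * S)ᵀ = Sᵀ * A * S := by
    simp only [Matrix.transpose_mul, Matrix.transpose_transpose, hsymm, Matrix.mul_assoc]
  have hCdet : (Sᵀ * A * S).det = (p : ℤ) ^ d := by
    have := Int.isUnit_mul_self hS
    rw [Matrix.det_mul, Matrix.det_mul, Matrix.det_transpose, mul_right_comm, this, one_mul, hdet]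
  have hCpos := hpos.congr hS
  generalize Sᵀ * A * S = C at *
  obtain ⟨a, b, c, m, o, rfl⟩ := EdgeWeights.exists_eq_gram hCsymm
  rw [EdgeWeights.det_gram] at hCdet
  obtain ⟨ha, hd, hD⟩ := hCpos.gram_minors_pos
  obtain ⟨h₁, h₂, h₃⟩ := hmin.gram_shift_nonneg
  have hab : a ≤ b := hmono (show (0 : Fin 4) ≤ 1 by decide)
  have hbc : b ≤ c := hmono (show (1 : Fin 4) ≤ 2 by decide)
  have hcm : c ≤ m := hmono (show (2 : Fin 4) ≤ 3 by decide)
  have ho : ¬ o.Disconnected := fun ho ↦ hdec ⟨_, EdgeWeights.decomposable_gram ho, hequiv⟩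
  obtain ⟨t, ht, hbound⟩ := exists_spanningTree_bound ha hab hbc hcm hd hD
    (hnonneg 1) (hnonneg 2) (hnonneg 3) (by linarith [h₁ (-1)]) h₂ h₃ ho (by
      rw [hCdet]
      intro h2
      have := Int.prime_two.dvd_of_dvd_pow h2
      exact hodd ((Nat.prime_dvd_prime_iff_eq Nat.prime_two hp).1 (by exact_mod_cast this)).symm)
  obtain ⟨s, hs, hsum⟩ := exists_posDef_form_of_spanningTree ht o
  refine ⟨_, s.form, hequiv, hCsymm, hs, ?_⟩
  rw [hCdet] at hbound
  refine le_trans (le_of_eq ?_) hbound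
  simp [Fin.sum_univ_four, EdgeWeights.form, EdgeWeights.gram]
  linarith
end

section
/- Let N ≥ 4 be a real number and let 𝓕 := {(α,β) ∈ ℝ² : 2 ≤ α ≤ (2N)^{1/3} and α ≤ β ≤ N^{1/2}}. Then the function f(α,β) = α + β + (4N + α·β²)/(4·α·β − α²) is convex on the convex polygon 𝓕. -/
theorem mul_mul_three_sub_sub_le_one {x y : ℝ} (hx : 0 < x) (hy : 0 < y) :
    x * y * (3 - x - y) ≤ 1 := by
  rcases le_total x 3 with h | h
  · have h₁ : 0 ≤ x * (1 - x * y * (3 - x - y)) := by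
      have h₂ : 0 ≤ x * (x - 1) ^ 2 * (4 - x) :=
        mul_nonneg (by positivity) (by linarith)
      nlinarith [sq_nonneg (x * y + (x ^ 2 - 3 * x) / 2)]
    linarith [nonneg_of_mul_nonneg_right h₁ hx]
  · nlinarith [mul_pos hx hy]

/-- The tangent plane of `1 / (u * v)` at `(u₀, v₀)` lies below its graph. -/
theorem tangent_le_one_div_mul {u v u₀ v₀ : ℝ} (hu : 0 < u) (hv : 0 < v)
    (hu₀ : 0 < u₀) (hv₀ : 0 < v₀) :
    1 / (u₀ * v₀) * (3 - u / u₀ - v / v₀) ≤ 1 / (u * v) := by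
  have h := mul_mul_three_sub_sub_le_one (div_pos hu hu₀) (div_pos hv hv₀)
  rw [le_div_iff₀ (mul_pos hu hv)]
  calc _ = u / u₀ * (v / v₀) * (3 - u / u₀ - v / v₀) := by field_simp
    _ ≤ 1 := h

/-- The tangent plane of `b ^ 2 / v` along the ray of slope `t` lies below its graph. -/
theorem tangent_le_sq_div {b v : ℝ} (hv : 0 < v) (t : ℝ) :
    2 * t * b - t ^ 2 * v ≤ b ^ 2 / v := by
  rw [le_div_iff₀ hv]
  nlinarith [sq_nonneg (b - t * v)]

theorem convexOn_one_div_mul :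
    ConvexOn ℝ {p : ℝ × ℝ | 0 < p.1 ∧ 0 < p.2} (fun p => 1 / (p.1 * p.2)) := by
  have hconv : Convex ℝ {p : ℝ × ℝ | 0 < p.1 ∧ 0 < p.2} :=
    (convex_Ioi (0 : ℝ)).prod (convex_Ioi (0 : ℝ))
  refine ⟨hconv, fun p hp q hq a b ha hb hab => ?_⟩
  obtain ⟨hu, hv⟩ := hconv hp hq ha hb hab
  have h₁ := mul_le_mul_of_nonneg_left (tangent_le_one_div_mul hp.1 hp.2 hu hv) ha
  have h₂ := mul_le_mul_of_nonneg_left (tangent_le_one_div_mul hq.1 hq.2 hu hv) hb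
  simp only [Prod.fst_add, Prod.snd_add, Prod.smul_fst, Prod.smul_snd, smul_eq_mul]
    at hu hv h₁ h₂ ⊢
  refine le_trans (le_of_eq ?_) (add_le_add h₁ h₂)
  generalize hU : a * p.1 + b * q.1 = U at *
  generalize hV : a * p.2 + b * q.2 = V at *
  have hsum : a * (3 - p.1 / U - p.2 / V) + b * (3 - q.1 / U - q.2 / V) = 1 := by
    calc _ = 3 * (a + b) - (a * p.1 + b * q.1) / U - (a * p.2 + b * q.2) / V := by ring
      _ = 1 := by rw [hab, hU, hV, div_self hu.ne', div_self hv.ne']; norm_num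
  linear_combination (-(1 / (U * V))) * hsum

theorem convexOn_sq_div :
    ConvexOn ℝ {p : ℝ × ℝ | 0 < p.2} (fun p => p.1 ^ 2 / p.2) := by
  have hconv : Convex ℝ {p : ℝ × ℝ | 0 < p.2} :=
    (convex_Ioi (0 : ℝ)).linear_preimage (LinearMap.snd ℝ ℝ ℝ)
  refine ⟨hconv, fun p hp q hq a b ha hb hab => ?_⟩
  have hv := hconv hp hq ha hb hab
  simp only [Set.mem_ofPred_eq, Prod.fst_add, Prod.snd_add, Prod.smul_fst, Prod.smul_snd,
    smul_eq_mul] at hv ⊢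
  generalize hB : a * p.1 + b * q.1 = B at *
  generalize hV : a * p.2 + b * q.2 = V at *
  have h₁ := mul_le_mul_of_nonneg_left (tangent_le_sq_div (b := p.1) hp (B / V)) ha
  have h₂ := mul_le_mul_of_nonneg_left (tangent_le_sq_div (b := q.1) hq (B / V)) hb
  refine le_trans (le_of_eq ?_) (add_le_add h₁ h₂)
  calc B ^ 2 / V = 2 * (B / V) * B - (B / V) ^ 2 * V := by field_simp; ring
    _ = _ := by rw [← hB, ← hV]; ring

/-- For a real number `N ≥ 4`, the function
`f(α,β) = α + β + (4N + αβ²)/(4αβ − α²)` is convex on the convex polygon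
`𝓕 = {(α,β) : 2 ≤ α ≤ (2N)^{1/3}, α ≤ β ≤ N^{1/2}}`. -/
theorem stmt7 (N : ℝ) (hN : 4 ≤ N) :
    ConvexOn ℝ
      {x : ℝ × ℝ | 2 ≤ x.1 ∧ x.1 ≤ (2 * N) ^ ((1 : ℝ) / 3) ∧
        x.1 ≤ x.2 ∧ x.2 ≤ N ^ ((1 : ℝ) / 2)}
      (fun x : ℝ × ℝ =>
        x.1 + x.2 + (4 * N + x.1 * x.2 ^ 2) / (4 * x.1 * x.2 - x.1 ^ 2)) := by
  let α : ℝ × ℝ →ₗ[ℝ] ℝ := LinearMap.fst ℝ ℝ ℝ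
  let β : ℝ × ℝ →ₗ[ℝ] ℝ := LinearMap.snd ℝ ℝ ℝ
  let γ : ℝ × ℝ →ₗ[ℝ] ℝ := (4 : ℝ) • β - α
  have hconv : Convex ℝ {x : ℝ × ℝ | 2 ≤ x.1 ∧ x.1 ≤ (2 * N) ^ ((1 : ℝ) / 3) ∧
      x.1 ≤ x.2 ∧ x.2 ≤ N ^ ((1 : ℝ) / 2)} := by
    have hdiag : Convex ℝ {x : ℝ × ℝ | x.1 ≤ x.2} := by
      simpa [α, β, sub_nonneg] using convex_halfSpace_ge (β - α).isLinear 0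
    exact (convex_halfSpace_ge α.isLinear 2).inter <|
      (convex_halfSpace_le α.isLinear _).inter <|
        hdiag.inter (convex_halfSpace_le β.isLinear _)
  have hone := (convexOn_one_div_mul.comp_linearMap (α.prod γ)).smul
    (show (0 : ℝ) ≤ 4 * N by linarith)
  have hsq := convexOn_sq_div.comp_linearMap (β.prod γ)
  have hγ : ∀ x : ℝ × ℝ, γ x = 4 * x.2 - x.1 := fun x => by simp [γ, α, β]
  have hone' := hone.subset (fun x hx => ⟨by
    change 0 < x.1; linarith [hx.1], by
    change 0 < γ x; rw [hγ]; linarith [hx.1, hx.2.2.1]⟩) hconv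
  have hsq' := hsq.subset (fun x hx => by
    change 0 < γ x; rw [hγ]; linarith [hx.1, hx.2.2.1]) hconv
  refine (((α + β).convexOn hconv).add (hone'.add hsq')).congr fun x hx => ?_
  have hα : 0 < x.1 := by linarith [hx.1]
  have hpos : 0 < 4 * x.2 - x.1 := by linarith [hx.1, hx.2.2.1]
  change x.1 + x.2 + (4 * N * (1 / (x.1 * γ x)) + x.2 ^ 2 / γ x) = _
  rw [hγ, show 4 * x.1 * x.2 - x.1 ^ 2 = x.1 * (4 * x.2 - x.1) by ring]
  field_simp
end

section
/- Let C ∈ ℤ^{9×9} be the symmetric matrix with rows (4,2,2,1,1,2,2,1,1), (2,4,2,1,2,1,1,2,1), (2,2,4,2,1,1,1,1,2), (1,1,2,4,1,2,1,2,2), (1,2,1,1,4,1,2,2,2), (2,1,1,2,1,4,2,2,1), (2,1,1,1,2,2,4,1,2), (1,2,1,2,2,2,1,4,1), (1,1,2,2,2,1,2,1,4). Then every matrix Q ∈ ℤ^{k×9} all of whose rows are nonzero and which satisfies Qᵀ·Q = C has at most 16 rows, i.e. k ≤ 16. -/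
open Matrix

/-- The Cartan matrix of the principal 2-block of `C₂⁴ ⋊ A`, `A ∈ Syl₃(Aut(C₂⁴))`. -/
def CartanC : Matrix (Fin 9) (Fin 9) ℤ :=
  !![4,2,2,1,1,2,2,1,1;
     2,4,2,1,2,1,1,2,1;
     2,2,4,2,1,1,1,1,2;
     1,1,2,4,1,2,1,2,2;
     1,2,1,1,4,1,2,2,2;
     2,1,1,2,1,4,2,2,1;
     2,1,1,1,2,2,4,1,2;
     1,2,1,2,2,2,1,4,1;
     1,1,2,2,2,1,2,1,4]

/-- Sixteen times the inverse of `CartanC`. -/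
def scaledInverse : Matrix (Fin 9) (Fin 9) ℤ :=
  !![9,-3,-3,1,1,-3,-3,1,1;
     -3,9,-3,1,-3,1,1,-3,1;
     -3,-3,9,-3,1,1,1,1,-3;
     1,1,-3,9,1,-3,1,-3,-3;
     1,-3,1,1,9,1,-3,-3,-3;
     -3,1,1,-3,1,9,-3,-3,1;
     -3,1,1,1,-3,-3,9,1,-3;
     1,-3,1,-3,-3,-3,1,9,1;
     1,1,-3,-3,-3,1,-3,1,9]

/-- Four times the quadratic form of the dual of the root lattice `A₃`. -/
def dualA3Form (a b c : ℤ) : ℤ :=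
  a ^ 2 + b ^ 2 + c ^ 2 + (a - b) ^ 2 + (a - c) ^ 2 + (b - c) ^ 2

lemma dualA3Form_nonneg (a b c : ℤ) : 0 ≤ dualA3Form a b c := by
  unfold dualA3Form
  positivity

lemma three_le_dualA3Form {a b c : ℤ} (h : ¬(a = 0 ∧ b = 0 ∧ c = 0)) :
    3 ≤ dualA3Form a b c := by
  have key : ∀ x : ℤ, 0 ≤ x ^ 2 ∧ (x ≠ 0 → 1 ≤ x ^ 2) := fun x =>
    ⟨sq_nonneg x, fun hx => Int.add_one_le_iff.mpr (sq_pos_of_ne_zero hx)⟩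
  have h₁ := key a
  have h₂ := key b
  have h₃ := key c
  have h₄ := key (a - b)
  have h₅ := key (a - c)
  have h₆ := key (b - c)
  unfold dualA3Form
  generalize a ^ 2 = s₁, b ^ 2 = s₂, c ^ 2 = s₃, (a - b) ^ 2 = s₄, (a - c) ^ 2 = s₅,
    (b - c) ^ 2 = s₆ at *
  omega

/-- The minimum of the tensor product of two copies of `dualA3Form` is at least `9`. -/
lemma nine_le_tensor_dualA3Form {a b c d e f g h i : ℤ}
    (hne : ¬((a = 0 ∧ b = 0 ∧ c = 0) ∧ (d = 0 ∧ e = 0 ∧ f = 0) ∧ (g = 0 ∧ h = 0 ∧ i = 0))) :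
    9 ≤ dualA3Form a b c + dualA3Form d e f + dualA3Form g h i
      + dualA3Form (a - d) (b - e) (c - f) + dualA3Form (a - g) (b - h) (c - i)
      + dualA3Form (d - g) (e - h) (f - i) := by
  have key : ∀ x y z : ℤ, 0 ≤ dualA3Form x y z ∧
      (¬(x = 0 ∧ y = 0 ∧ z = 0) → 3 ≤ dualA3Form x y z) := fun x y z =>
    ⟨dualA3Form_nonneg x y z, three_le_dualA3Form⟩
  have h₁ := key a b c
  have h₂ := key d e f
  have h₃ := key g h i
  have h₄ := key (a - d) (b - e) (c - f)
  have h₅ := key (a - g) (b - h) (c - i)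
  have h₆ := key (d - g) (e - h) (f - i)
  generalize dualA3Form a b c = s₁, dualA3Form d e f = s₂, dualA3Form g h i = s₃,
    dualA3Form (a - d) (b - e) (c - f) = s₄, dualA3Form (a - g) (b - h) (c - i) = s₅,
    dualA3Form (d - g) (e - h) (f - i) = s₆ at *
  by_cases p : a = 0 ∧ b = 0 ∧ c = 0 <;> by_cases q : d = 0 ∧ e = 0 ∧ f = 0 <;>
    by_cases r : g = 0 ∧ h = 0 ∧ i = 0 <;>
    by_cases u : a - d = 0 ∧ b - e = 0 ∧ c - f = 0 <;>
    by_cases v : a - g = 0 ∧ b - h = 0 ∧ c - i = 0 <;>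
    by_cases w : d - g = 0 ∧ e - h = 0 ∧ f - i = 0 <;>
    simp only [p, q, r, u, v, w, not_true_eq_false, not_false_eq_true, true_implies,
      false_implies, and_true] at h₁ h₂ h₃ h₄ h₅ h₆ <;>
    omega

/-- The grid arrangement of indices used here exhibits `CartanC` as a Kronecker square. -/
lemma nine_le_scaledInverse_form (x : Fin 9 → ℤ) (hx : ∃ j, x j ≠ 0) :
    9 ≤ ∑ a, ∑ b, scaledInverse a b * (x a * x b) := by
  have hne : ¬((x 0 = 0 ∧ x 1 = 0 ∧ x 2 = 0) ∧ (x 5 = 0 ∧ x 7 = 0 ∧ x 3 = 0) ∧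
      (x 6 = 0 ∧ x 4 = 0 ∧ x 8 = 0)) := by
    rintro ⟨⟨h0, h1, h2⟩, ⟨h5, h7, h3⟩, h6, h4, h8⟩
    obtain ⟨j, hj⟩ := hx
    fin_cases j <;> exact hj ‹_›
  refine (nine_le_tensor_dualA3Form hne).trans_eq ?_
  simp only [dualA3Form, scaledInverse, Fin.sum_univ_succ, Matrix.of_apply]
  simp
  ring

lemma sum_scaledInverse_mul_cartanC :
    ∑ a, ∑ b, scaledInverse a b * CartanC a b = 144 := by
  simp [scaledInverse, CartanC, Fin.sum_univ_succ]

/-- Every integer matrix `Q ∈ ℤ^{k×9}` with all rows nonzero and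
`Qᵀ · Q = C` (for the Cartan matrix `C` above) has at most `16` rows. -/
theorem stmt9 (k : ℕ) (Q : Matrix (Fin k) (Fin 9) ℤ)
    (hrows : ∀ i : Fin k, ∃ j : Fin 9, Q i j ≠ 0)
    (hQ : Qᵀ * Q = CartanC) :
    k ≤ 16 := by
  have hsum : ∑ i, ∑ a, ∑ b, scaledInverse a b * (Q i a * Q i b) = 144 := by
    rw [← sum_scaledInverse_mul_cartanC, ← hQ, Finset.sum_comm]
    refine Finset.sum_congr rfl fun a _ => ?_
    rw [Finset.sum_comm]
    simp only [Matrix.mul_apply, Matrix.transpose_apply, Finset.mul_sum]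
  have hle : ∑ _i : Fin k, (9 : ℤ) ≤ 144 :=
    (Finset.sum_le_sum fun i _ => nine_le_scaledInverse_form (Q i) (hrows i)).trans_eq hsum
  simp only [Finset.sum_const, Finset.card_univ, Fintype.card_fin, nsmul_eq_mul] at hle
  omega
end

section
/- Every symmetric positive definite matrix A ∈ ℤ^{2×2} whose Smith normal form is diag(2,16) (i.e. there exist U, V ∈ GL(2,ℤ) with U·A·V = diag(2,16)) is equivalent to diag(2,16) or to the matrix with rows (6,2) and (2,6). -/
open Matrix

/-- Reduction theory for binary quadratic forms `a x² + 2 b x y + c y²` with `a * c - b ^ 2 = 8`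
whose coefficients are not all even. -/
theorem exists_reduction_of_mul_sub_sq_eq_eight (n : ℕ) : ∀ a b c : ℤ, 0 < a → 0 < c →
    a + c ≤ n → a * c - b ^ 2 = 8 → ¬ (2 ∣ a ∧ 2 ∣ b ∧ 2 ∣ c) →
    ∃ p q r s : ℤ, (p * s - q * r) ^ 2 = 1 ∧
      ((a = p ^ 2 + 8 * r ^ 2 ∧ b = p * q + 8 * r * s ∧ c = q ^ 2 + 8 * s ^ 2) ∨
        (a = 3 * p ^ 2 + 2 * p * r + 3 * r ^ 2 ∧ b = 3 * p * q + p * s + q * r + 3 * r * s ∧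
          c = 3 * q ^ 2 + 2 * q * s + 3 * s ^ 2)) := by
  induction n with
  | zero => intro a b c ha hc h; push_cast at h; omega
  | succ n ih =>
    intro a b c ha hc hn hdet hodd
    push_cast at hn
    by_cases h1 : a < 2 * b
    · obtain ⟨p, q, r, s, hu, h⟩ := ih a (b - a) (c - 2 * b + a) ha
        (pos_of_mul_pos_right (a := a) (by nlinarith [sq_nonneg (b - a)]) ha.le) (by omega)
        (by linear_combination hdet) (by omega)
      refine ⟨p, p + q, r, r + s, by linear_combination hu, ?_⟩
      rcases h with ⟨h1, h2, h3⟩ | ⟨h1, h2, h3⟩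
      · exact .inl ⟨h1, by linear_combination h2 + h1, by linear_combination h3 + 2 * h2 + h1⟩
      · exact .inr ⟨h1, by linear_combination h2 + h1, by linear_combination h3 + 2 * h2 + h1⟩
    by_cases h2 : a < -(2 * b)
    · obtain ⟨p, q, r, s, hu, h⟩ := ih a (b + a) (c + 2 * b + a) ha
        (pos_of_mul_pos_right (a := a) (by nlinarith [sq_nonneg (b + a)]) ha.le) (by omega)
        (by linear_combination hdet) (by omega)
      refine ⟨p, q - p, r, s - r, by linear_combination hu, ?_⟩
      rcases h with ⟨h1, h2, h3⟩ | ⟨h1, h2, h3⟩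
      · exact .inl ⟨h1, by linear_combination h2 - h1, by linear_combination h3 - 2 * h2 + h1⟩
      · exact .inr ⟨h1, by linear_combination h2 - h1, by linear_combination h3 - 2 * h2 + h1⟩
    by_cases h3 : c < 2 * b
    · obtain ⟨p, q, r, s, hu, h⟩ := ih (a - 2 * b + c) (b - c) c
        (pos_of_mul_pos_right (a := c) (by nlinarith [sq_nonneg (b - c)]) hc.le) hc (by omega)
        (by linear_combination hdet) (by omega)
      refine ⟨p + q, q, r + s, s, by linear_combination hu, ?_⟩
      rcases h with ⟨h1, h2, h3⟩ | ⟨h1, h2, h3⟩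
      · exact .inl ⟨by linear_combination h1 + 2 * h2 + h3, by linear_combination h2 + h3, h3⟩
      · exact .inr ⟨by linear_combination h1 + 2 * h2 + h3, by linear_combination h2 + h3, h3⟩
    by_cases h4 : c < -(2 * b)
    · obtain ⟨p, q, r, s, hu, h⟩ := ih (a + 2 * b + c) (b + c) c
        (pos_of_mul_pos_right (a := c) (by nlinarith [sq_nonneg (b + c)]) hc.le) hc (by omega)
        (by linear_combination hdet) (by omega)
      refine ⟨p - q, q, r - s, s, by linear_combination hu, ?_⟩
      rcases h with ⟨h1, h2, h3⟩ | ⟨h1, h2, h3⟩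
      · exact .inl ⟨by linear_combination h1 - 2 * h2 + h3, by linear_combination h2 - h3, h3⟩
      · exact .inr ⟨by linear_combination h1 - 2 * h2 + h3, by linear_combination h2 - h3, h3⟩
    push Not at h1 h2 h3 h4
    have hb : 3 * b ^ 2 ≤ 8 := by
      rcases le_total 0 b with hb | hb
      · nlinarith [mul_le_mul h1 h3 (by omega) ha.le]
      · nlinarith [mul_le_mul h2 h4 (by omega) ha.le]
    have hb1 : b ≤ 1 := by nlinarith
    have hb2 : -1 ≤ b := by nlinarith
    have ha9 : a ≤ 9 := by nlinarith
    clear ih hn hb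
    interval_cases b <;> interval_cases a <;> try omega
    · exact ⟨1, 0, 0, -1, by norm_num, .inr (by omega)⟩
    · exact ⟨1, 0, 0, 1, by norm_num, .inl (by omega)⟩
    · exact ⟨0, 1, 1, 0, by norm_num, .inl (by omega)⟩
    · exact ⟨1, 0, 0, 1, by norm_num, .inr (by omega)⟩

/-- Every symmetric positive definite `2 × 2` integer matrix with
Smith normal form `diag(2, 16)` is equivalent to `diag(2, 16)` or to `!![6,2;2,6]`. -/
theorem stmt10 (A : Matrix (Fin 2) (Fin 2) ℤ) (hsymm : Aᵀ = A) (hpos : IntPosDef A)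
    (hsnf : ∃ U V : Matrix (Fin 2) (Fin 2) ℤ, IsUnit U.det ∧ IsUnit V.det ∧
      U * A * V = !![2, 0; 0, 16]) :
    MatrixEquiv A !![2, 0; 0, 16] ∨ MatrixEquiv A !![6, 2; 2, 6] := by
  obtain ⟨U, V, hU, hV, hUAV⟩ := hsnf
  have hdvd : ∀ i j, 2 ∣ A i j := by
    have hD : (!![2, 0; 0, 16] : Matrix (Fin 2) (Fin 2) ℤ) = (2 : ℤ) • !![1, 0; 0, 8] := by
      ext i j; fin_cases i <;> fin_cases j <;> rfl
    have hA : A = (2 : ℤ) • (U⁻¹ * !![1, 0; 0, 8] * V⁻¹) := by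
      rw [← smul_mul_assoc, ← mul_smul_comm, ← hD, ← hUAV, mul_assoc U,
        Matrix.nonsing_inv_mul_cancel_left _ _ hU, Matrix.mul_nonsing_inv_cancel_right _ _ hV]
    intro i j
    rw [hA]
    exact ⟨_, rfl⟩
  have hs : A 1 0 = A 0 1 := congrFun (congrFun hsymm 0) 1
  obtain ⟨a, ha⟩ := hdvd 0 0
  obtain ⟨b, hb⟩ := hdvd 0 1
  obtain ⟨c, hc⟩ := hdvd 1 1
  rw [hb] at hs
  have hA : A = !![2 * a, 2 * b; 2 * b, 2 * c] := by
    rw [Matrix.eta_fin_two A, ha, hb, hs, hc]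
  subst hA
  have hval : ∀ x y : ℤ, (x ≠ 0 ∨ y ≠ 0) → 0 < a * x ^ 2 + 2 * b * x * y + c * y ^ 2 := by
    intro x y hxy
    have h := hpos ![x, y] (by
      intro h
      have h0 := congrFun h 0
      have h1 := congrFun h 1
      simp at h0 h1
      omega)
    simp [Fin.sum_univ_two] at h
    have h' : (0 : ℝ) < ((a * x ^ 2 + 2 * b * x * y + c * y ^ 2 : ℤ) : ℝ) := by
      push_cast
      linarith
    exact_mod_cast h'
  have hapos : 0 < a := by simpa using hval 1 0 (by simp)
  have hcpos : 0 < c := by simpa using hval 0 1 (by simp)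
  have hdpos : 0 < a * c - b ^ 2 := by
    have h := hval (-b) a (.inr hapos.ne')
    exact pos_of_mul_pos_right (a := a) (by linarith) hapos.le
  have hdet : a * c - b ^ 2 = 8 := by
    have h := congrArg Matrix.det hUAV
    rw [Matrix.det_mul, Matrix.det_mul, Matrix.det_fin_two_of, Matrix.det_fin_two_of] at h
    rcases Int.isUnit_iff.mp hU with hu | hu <;> rcases Int.isUnit_iff.mp hV with hv | hv <;>
      rw [hu, hv] at h <;> linarith
  have hodd : ¬ (2 ∣ a ∧ 2 ∣ b ∧ 2 ∣ c) := by
    rintro ⟨⟨a, rfl⟩, ⟨b, rfl⟩, ⟨c, rfl⟩⟩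
    have h := congrFun (congrFun hUAV 0) 0
    simp [Matrix.mul_apply, Fin.sum_univ_two] at h
    have h4 : (4 : ℤ) ∣ 2 := ⟨(U 0 0 * a + U 0 1 * b) * V 0 0 + (U 0 0 * b + U 0 1 * c) * V 1 0,
      by linear_combination -h⟩
    omega
  obtain ⟨p, q, r, s, hu, h⟩ := exists_reduction_of_mul_sub_sq_eq_eight (a + c).toNat a b c
    hapos hcpos (Int.self_le_toNat _) hdet hodd
  have hS : IsUnit (!![p, q; r, s] : Matrix (Fin 2) (Fin 2) ℤ).det := by
    rw [Matrix.det_fin_two_of]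
    exact IsUnit.of_pow_eq_one hu two_ne_zero
  rcases h with ⟨rfl, rfl, rfl⟩ | ⟨rfl, rfl, rfl⟩
  · refine .inl ⟨_, hS, ?_⟩
    ext i j
    fin_cases i <;> fin_cases j <;> simp [Matrix.mul_apply, Fin.sum_univ_two] <;> ring
  · refine .inr ⟨_, hS, ?_⟩
    ext i j
    fin_cases i <;> fin_cases j <;> simp [Matrix.mul_apply, Fin.sum_univ_two] <;> ring
end
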